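/- Let A and C be abelian groups. Then there exists a superperfect strongly torsion generated group S (i.e. H_1(S) = 0 and H_2(S) = 0) whose centre is isomorphic to A and such that H_3(S) is isomorphic to C. -/

import Mathlib

open CategoryTheory AlgebraicTopology

/-- The chain complex (over `ℤ`) associated to the nerve of the one-object groupoid on a
group `G`, i.e. the simplicial chain complex of the classifying space `BG`; its homology in
positive degrees is the integral group homology of `G`. -/
noncomputable def classifyingComplex (G : Type) [Group G] : ChainComplex (ModuleCat ℤ) ℕ :=
  (alternatingFaceMapComplex (ModuleCat ℤ)).obj
    (((SimplicialObject.whiskering (Type) (ModuleCat ℤ)).obj (ModuleCat.free ℤ)).obj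
      (nerve (SingleObj G)))

/-- The integral group homology `H_n(G; ℤ)` of a group `G`. -/
noncomputable def grpHomology (G : Type) [Group G] (n : ℕ) : ModuleCat ℤ :=
  (classifyingComplex G).homology n

/-- A group `G` is strongly torsion generated if for every `n ≥ 2` there is an element of
order exactly `n` whose normal closure is all of `G`. -/
def StronglyTorsionGenerated (G : Type*) [Group G] : Prop :=
  ∀ n : ℕ, 2 ≤ n → ∃ g : G, orderOf g = n ∧ Subgroup.normalClosure {g} = ⊤


/-! ## The bar complex in cocycle form -/

/-- An `n`-simplex of the classifying space of `G`, in cocycle form. -/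
@[ext]
structure Smp (G : Type) [Group G] (n : ℕ) where
  g : Fin (n + 1) → Fin (n + 1) → G
  mul' : ∀ i j k, g i j * g j k = g i k

namespace Smp
variable {G H : Type} [Group G] [Group H]

lemma self {n : ℕ} (x : Smp G n) (i : Fin (n + 1)) : x.g i i = 1 := by
  have := x.mul' i i i
  simpa using this

/-- Pull back a simplex along any map of vertices. -/
def pull {m n : ℕ} (θ : Fin (m + 1) → Fin (n + 1)) (x : Smp G n) : Smp G m where
  g i j := x.g (θ i) (θ j)
  mul' _ _ _ := x.mul' _ _ _

@[simp] lemma pull_g {m n : ℕ} (θ : Fin (m + 1) → Fin (n + 1)) (x : Smp G n) (i j) :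
    (pull θ x).g i j = x.g (θ i) (θ j) := rfl

lemma pull_pull {l m n : ℕ} (η : Fin (l + 1) → Fin (m + 1)) (θ : Fin (m + 1) → Fin (n + 1))
    (x : Smp G n) : pull η (pull θ x) = pull (θ ∘ η) x := rfl

/-- Functoriality. -/
def map (f : G →* H) {n : ℕ} (x : Smp G n) : Smp H n where
  g i j := f (x.g i j)
  mul' i j k := by rw [← map_mul, x.mul']

@[simp] lemma map_g (f : G →* H) {n : ℕ} (x : Smp G n) (i j) :
    (map f x).g i j = f (x.g i j) := rfl

/-- Comparison with inhomogeneous simplices. -/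
def tupleEquiv (n : ℕ) : Smp G n ≃ (Fin n → G) where
  toFun x i := x.g i.castSucc i.succ
  invFun t :=
    { g := fun i j => (Fin.partialProd t i)⁻¹ * Fin.partialProd t j
      mul' := fun i j k => by group }
  left_inv x := by
    have key : ∀ i : Fin (n + 1),
        Fin.partialProd (fun i : Fin n => x.g i.castSucc i.succ) i = x.g 0 i := by
      intro i
      induction i using Fin.induction with
      | zero => simp [x.self]
      | succ i ih => rw [Fin.partialProd_succ, ih, x.mul']
    ext i j
    simp only [key]
    rw [inv_mul_eq_iff_eq_mul, x.mul']
  right_inv t := by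
    funext i
    exact Fin.partialProd_right_inv t i

lemma tuple_pull_zero {n : ℕ} (x : Smp G (n + 1)) :
    tupleEquiv n (pull (Fin.succAbove 0) x) = fun i => tupleEquiv (n + 1) x i.succ := by
  funext i
  simp [tupleEquiv]

lemma tuple_pull_succ {n : ℕ} (x : Smp G (n + 1)) (j : Fin (n + 1)) :
    tupleEquiv n (pull (Fin.succAbove j.succ) x) =
      Fin.contractNth j (· * ·) (tupleEquiv (n + 1) x) := by
  obtain ⟨t, rfl⟩ := (tupleEquiv (n + 1)).symm.surjective x
  rw [Equiv.apply_symm_apply]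
  funext k
  rw [← Fin.inv_partialProd_mul_eq_contractNth]
  show (Fin.partialProd t _)⁻¹ * Fin.partialProd t _ = _
  congr 3
  simp [Fin.succ_succAbove_succ]

end Smp

/-- Chains -/
abbrev Ch (G : Type) [Group G] (n : ℕ) := Smp G n →₀ ℤ

section chains
variable {G H : Type} [Group G] [Group H]

/-- the boundary -/
noncomputable def bd (G : Type) [Group G] (n : ℕ) : Ch G (n + 1) →ₗ[ℤ] Ch G n :=
  ∑ i : Fin (n + 2), (-1 : ℤ) ^ (i : ℕ) • Finsupp.lmapDomain ℤ ℤ (Smp.pull (Fin.succAbove i))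

lemma bd_single (n : ℕ) (x : Smp G (n + 1)) (c : ℤ) :
    bd G n (Finsupp.single x c) =
      ∑ i : Fin (n + 2), (-1 : ℤ) ^ (i : ℕ) •
        Finsupp.single (Smp.pull (Fin.succAbove i) x) c := by
  simp [bd, LinearMap.sum_apply, Finsupp.mapDomain_single]

/-- Comparison of chains. -/
noncomputable def tupleLEquiv (G : Type) [Group G] (n : ℕ) :
    Ch G n ≃ₗ[ℤ] ((Fin n → G) →₀ ℤ) :=
  Finsupp.domLCongr (Smp.tupleEquiv n)

lemma tupleLEquiv_bd (n : ℕ) (x : Ch G (n + 1)) :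
    tupleLEquiv G n (bd G n x) =
      (groupHomology.inhomogeneousChains.d (Rep.trivial ℤ G ℤ) n).hom
        (tupleLEquiv G (n + 1) x) := by
  induction x using Finsupp.induction_linear with
  | zero => simp
  | add f g hf hg => simp only [map_add, hf, hg]
  | single x c =>
    rw [bd_single]
    have h := groupHomology.inhomogeneousChains.d_single (A := Rep.trivial ℤ G ℤ) n
      (Smp.tupleEquiv (n + 1) x) c
    simp only [tupleLEquiv, Finsupp.domLCongr_single, map_sum, map_zsmul]
    refine Eq.trans ?_ h.symm
    rw [Fin.sum_univ_succ]
    congr 1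
    · simp only [Smp.tuple_pull_zero]
      simp
    · refine Finset.sum_congr rfl fun j _ => ?_
      rw [Smp.tuple_pull_succ]
      rfl

lemma bd_bd (n : ℕ) (x : Ch G (n + 2)) : bd G n (bd G (n + 1) x) = 0 := by
  apply (tupleLEquiv G n).injective
  rw [tupleLEquiv_bd, tupleLEquiv_bd, map_zero]
  have := groupHomology.inhomogeneousChains.d_comp_d (Rep.trivial ℤ G ℤ) n
  exact congrArg (fun f => f.hom (tupleLEquiv G (n + 2) x)) this

/-- functoriality of chains -/
noncomputable def cm (f : G →* H) (n : ℕ) : Ch G n →ₗ[ℤ] Ch H n :=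
  Finsupp.lmapDomain ℤ ℤ (Smp.map f)

@[simp] lemma cm_single (f : G →* H) (n : ℕ) (x : Smp G n) (c : ℤ) :
    cm f n (Finsupp.single x c) = Finsupp.single (Smp.map f x) c := by
  simp [cm, Finsupp.mapDomain_single]

lemma cm_bd (f : G →* H) (n : ℕ) (x : Ch G (n + 1)) :
    cm f n (bd G n x) = bd H n (cm f (n + 1) x) := by
  induction x using Finsupp.induction_linear with
  | zero => simp
  | add f g hf hg => simp only [map_add, hf, hg]
  | single x c =>
    simp only [bd_single, map_sum, map_zsmul, cm_single]
    rfl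

lemma cm_comp {K : Type} [Group K] (f : G →* H) (g : H →* K) (n : ℕ) (x : Ch G n) :
    cm (g.comp f) n x = cm g n (cm f n x) := by
  induction x using Finsupp.induction_linear with
  | zero => simp
  | add f g hf hg => simp only [map_add, hf, hg]
  | single x c => simp only [cm_single]; rfl

lemma cm_id (n : ℕ) (x : Ch G n) : cm (MonoidHom.id G) n x = x := by
  induction x using Finsupp.induction_linear with
  | zero => simp
  | add f g hf hg => simp only [map_add, hf, hg]
  | single x c => simp only [cm_single]; rfl

/-- The homology of `G` in degree `n + 1`. -/
abbrev PH (G : Type) [Group G] (n : ℕ) :=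
  LinearMap.ker (bd G n) ⧸ (LinearMap.range (bd G (n + 1))).comap (LinearMap.ker (bd G n)).subtype

end chains

lemma homology_equiv_ring {R : Type} [CommRing R] (K : ChainComplex (ModuleCat.{0} R) ℕ)
    (M : ℕ → Type) [∀ n, AddCommGroup (M n)] [∀ n, Module R (M n)]
    (d : ∀ n, M (n + 1) →ₗ[R] M n)
    (e : ∀ n, K.X n ≃ₗ[R] M n)
    (he : ∀ n (x : K.X (n + 1)), e n ((K.d (n + 1) n).hom x) = d n (e (n + 1) x)) (n : ℕ) :
    Nonempty (K.homology (n + 1) ≃+ (LinearMap.ker (d n) ⧸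
      (LinearMap.range (d (n + 1))).comap (LinearMap.ker (d n)).subtype)) := by
  have i1 : K.homology (n + 1) ≅ (K.sc' (n + 2) (n + 1) n).homology :=
    ShortComplex.homologyMapIso (K.isoSc' (n + 2) (n + 1) n (by simp) (by simp))
  have i2 := (K.sc' (n + 2) (n + 1) n).moduleCatHomologyIso
  let e1 : LinearMap.ker (K.d (n + 1) n).hom ≃ₗ[R] LinearMap.ker (d n) :=
    (e (n + 1)).ofSubmodules _ _ (by
      ext y
      simp only [Submodule.mem_map, LinearMap.mem_ker]
      constructor
      · rintro ⟨x, hx, rfl⟩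
        have := he n x
        rw [hx, map_zero] at this
        exact this.symm
      · intro hy
        refine ⟨(e (n + 1)).symm y, ?_, by simp⟩
        apply (e n).injective
        rw [he]; simpa using hy)
  refine ⟨((i1 ≪≫ i2).toLinearEquiv.toAddEquiv).trans (Submodule.Quotient.equiv
    (LinearMap.range (K.sc' (n + 2) (n + 1) n).moduleCatToCycles) _ e1 ?_).toAddEquiv⟩
  ext ⟨y, hy⟩
  simp only [Submodule.mem_map, Submodule.mem_comap, LinearMap.mem_range]
  constructor
  · rintro ⟨x, ⟨w, rfl⟩, h⟩
    refine ⟨e (n + 2) w, ?_⟩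
    have := he (n + 1) w
    rw [← this]
    exact congrArg Subtype.val h
  · rintro ⟨w, hw⟩
    refine ⟨_, ⟨(e (n + 2)).symm w, rfl⟩, ?_⟩
    apply Subtype.ext
    show e (n + 1) ((K.d (n + 2) (n + 1)).hom _) = y
    rw [he]
    simpa using hw

lemma homology_equiv_of (K : ChainComplex (ModuleCat.{0} ℤ) ℕ) (G : Type) [Group G]
    (e : ∀ n, K.X n ≃ₗ[ℤ] Ch G n)
    (he : ∀ n (x : K.X (n + 1)), e n ((K.d (n + 1) n).hom x) = bd G n (e (n + 1) x)) (n : ℕ) :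
    Nonempty (K.homology (n + 1) ≃+ PH G n) :=
  homology_equiv_ring K (fun n => Ch G n) (bd G) e he n

/-- Comparison with mathlib's group homology. -/
lemma groupHomology_equiv (G : Type) [Group G] (n : ℕ) :
    Nonempty (groupHomology (Rep.trivial ℤ G ℤ) (n + 1) ≃+ PH G n) := by
  refine homology_equiv_of (groupHomology.inhomogeneousChains (Rep.trivial ℤ G ℤ)) G
    (fun n => (tupleLEquiv G n).symm) ?_ n
  intro n x
  rw [LinearEquiv.symm_apply_eq, tupleLEquiv_bd]
  rw [groupHomology.inhomogeneousChains.d_def]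
  congr 1
  exact ((tupleLEquiv G (n+1)).apply_symm_apply x).symm

/-- simplices of the nerve in cocycle form -/
def nerveSmp (G : Type) [Group G] (n : ℕ) : ComposableArrows (SingleObj G) n ≃ Smp G n where
  toFun F :=
    { g := fun i j =>
        (show G from F.map (homOfLE (Fin.zero_le i))) *
          (show G from F.map (homOfLE (Fin.zero_le j)))⁻¹
      mul' := fun i j k => by group }
  invFun x :=
    { obj := fun _ => SingleObj.star G
      map := fun {i j} _ => (show G from x.g j i)
      map_id := fun i => x.self i
      map_comp := fun {i j k} _ _ => (x.mul' k j i).symm }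
  left_inv F := by
    refine CategoryTheory.Functor.ext (fun _ => rfl) ?_
    intro i j f
    simp only [eqToHom_refl, Category.id_comp, Category.comp_id]
    have h : F.map (homOfLE (Fin.zero_le j)) = F.map (homOfLE (Fin.zero_le i)) ≫ F.map f := by
      rw [← F.map_comp]; rfl
    rw [h]
    show (show G from F.map f) * (show G from F.map (homOfLE (Fin.zero_le i))) *
      (show G from F.map (homOfLE (Fin.zero_le i)))⁻¹ = F.map f
    exact mul_inv_cancel_right _ _
  right_inv x := by
    ext i j
    show x.g i 0 * (x.g j 0)⁻¹ = x.g i j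
    rw [mul_inv_eq_iff_eq_mul, x.mul']

lemma nerveSmp_δ (G : Type) [Group G] (n : ℕ) (F : ComposableArrows (SingleObj G) (n + 1))
    (i : Fin (n + 2)) :
    nerveSmp G n ((nerve (SingleObj G)).δ i F) = Smp.pull (Fin.succAbove i) (nerveSmp G (n + 1) F) := by
  obtain ⟨x, rfl⟩ := (nerveSmp G (n + 1)).symm.surjective F
  rw [Equiv.apply_symm_apply]
  ext a b
  show x.g (i.succAbove a) (i.succAbove 0) * (x.g (i.succAbove b) (i.succAbove 0))⁻¹ = x.g _ _
  rw [mul_inv_eq_iff_eq_mul, x.mul']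

lemma grpHomology_equiv (G : Type) [Group G] (n : ℕ) :
    Nonempty (grpHomology G (n + 1) ≃+ PH G n) := by
  refine homology_equiv_of (classifyingComplex G) G
    (fun n => Finsupp.domLCongr (nerveSmp G n)) ?_ n
  intro n x
  let X := ((SimplicialObject.whiskering (Type) (ModuleCat ℤ)).obj (ModuleCat.free ℤ)).obj
      (nerve (SingleObj G))
  have hd : (classifyingComplex G).d (n + 1) n = AlternatingFaceMapComplex.objD X n :=
    alternatingFaceMapComplex_obj_d _ n
  rw [hd]
  refine DFunLike.congr_fun (f := (Finsupp.domLCongr (nerveSmp G n)).toLinearMap.comp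
    (AlternatingFaceMapComplex.objD X n).hom)
    (g := (bd G n).comp (Finsupp.domLCongr (nerveSmp G (n + 1))).toLinearMap) ?_ x
  refine Finsupp.lhom_ext (R := ℤ) fun x c => ?_
  have h2 : ∀ w : X.obj (Opposite.op (SimplexCategory.mk (n + 1))),
      (AlternatingFaceMapComplex.objD X n).hom w =
      ∑ i : Fin (n + 2), (-1 : ℤ) ^ (i : ℕ) • (X.δ i).hom w := by
    intro w
    simp only [AlternatingFaceMapComplex.objD, ModuleCat.hom_sum, LinearMap.sum_apply]
    rfl
  refine (congrArg (Finsupp.domLCongr (M := ℤ) (R := ℤ) (nerveSmp G n)) (h2 (Finsupp.single x c))).trans ?_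
  refine Eq.trans ?_ (congrArg (bd G n) (Finsupp.domLCongr_single _ _ _).symm)
  rw [bd_single]
  refine (map_sum (Finsupp.domLCongr (M := ℤ) (R := ℤ) (nerveSmp G n)) _ _).trans ?_
  refine Finset.sum_congr rfl fun i _ => ?_
  refine (map_zsmul (Finsupp.domLCongr (M := ℤ) (R := ℤ) (nerveSmp G n)) _ _).trans ?_
  congr 1
  refine Eq.trans ?_ (congrArg (fun y => Finsupp.single y c) (nerveSmp_δ G n x i))
  refine Eq.trans ?_ (Finsupp.domLCongr_single (M := ℤ) (R := ℤ) _ _ _)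
  refine congrArg (Finsupp.domLCongr (M := ℤ) (R := ℤ) (nerveSmp G n)) ?_
  exact Finsupp.mapDomain_single


/-! ## Prisms -/

lemma prism_sum {M : Type} [AddCommGroup M] (n : ℕ) (T U : ℕ → ℕ → M) (V : ℕ → M)
    (h1 : ∀ i j, i < j → j ≤ n → T i j = U i (j - 1))
    (h2 : ∀ j, j ≤ n → T j j = V j)
    (h3 : ∀ j, j ≤ n → T (j + 1) j = V (j + 1))
    (h4 : ∀ i j, j + 1 < i → i ≤ n + 1 → T i j = U (i - 1) j) :
    ∑ j ∈ Finset.range (n + 1), ∑ i ∈ Finset.range (n + 2), (-1 : ℤ) ^ (i + j) • T i j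
     + ∑ j ∈ Finset.range n, ∑ i ∈ Finset.range (n + 1), (-1 : ℤ) ^ (i + j) • U i j
      = V 0 - V (n + 1) := by
  have hA : ∀ j ∈ Finset.range (n + 1), ∑ i ∈ Finset.range (n + 2), (-1 : ℤ) ^ (i + j) • T i j =
      ∑ i ∈ Finset.range j, (-1 : ℤ) ^ (i + j) • U i (j - 1) + (V j - V (j + 1)) -
        ∑ i ∈ Finset.range (n - j), (-1 : ℤ) ^ (j + 1 + i + j) • U (j + 1 + i) j := by
    intro j hj
    have hj' : j ≤ n := by simpa [Nat.lt_succ_iff] using hj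
    obtain ⟨k, rfl⟩ := Nat.exists_eq_add_of_le hj'
    rw [show j + k + 2 = j + 1 + 1 + k by ring, Finset.sum_range_add, Finset.sum_range_succ,
      Finset.sum_range_succ, h2 j hj', h3 j hj', show j + k - j = k by omega]
    have e1 : ∑ i ∈ Finset.range j, (-1 : ℤ) ^ (i + j) • T i j =
        ∑ i ∈ Finset.range j, (-1 : ℤ) ^ (i + j) • U i (j - 1) :=
      Finset.sum_congr rfl fun i hi => by rw [h1 i j (by simpa using hi) hj']
    have e2 : ∑ i ∈ Finset.range k, (-1 : ℤ) ^ (j + 1 + 1 + i + j) • T (j + 1 + 1 + i) j =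
        - ∑ i ∈ Finset.range k, (-1 : ℤ) ^ (j + 1 + i + j) • U (j + 1 + i) j := by
      rw [← Finset.sum_neg_distrib]
      refine Finset.sum_congr rfl fun i hi => ?_
      have := Finset.mem_range.1 hi
      rw [h4 (j + 1 + 1 + i) j (by omega) (by omega),
        show j + 1 + 1 + i - 1 = j + 1 + i by omega,
        show j + 1 + 1 + i + j = j + 1 + i + j + 1 by ring, pow_succ]
      simp
    have e3 : (-1 : ℤ) ^ (j + j) = 1 := Even.neg_one_pow ⟨j, rfl⟩
    have e4 : (-1 : ℤ) ^ (j + 1 + j) = -1 := Odd.neg_one_pow ⟨j, by ring⟩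
    rw [e1, e2, e3, e4]
    simp only [one_smul, neg_smul]
    abel
  rw [Finset.sum_congr rfl hA, Finset.sum_sub_distrib, Finset.sum_add_distrib,
    Finset.sum_range_sub', Finset.sum_range_succ', Finset.sum_range_succ (fun j =>
      ∑ i ∈ Finset.range (n - j), (-1 : ℤ) ^ (j + 1 + i + j) • U (j + 1 + i) j)]
  have hB : ∑ j ∈ Finset.range n, ∑ i ∈ Finset.range (n + 1), (-1 : ℤ) ^ (i + j) • U i j =
      ∑ j ∈ Finset.range n, ∑ i ∈ Finset.range (n - j), (-1 : ℤ) ^ (j + 1 + i + j) • U (j + 1 + i) j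
      - ∑ j ∈ Finset.range n, ∑ i ∈ Finset.range (j + 1), (-1 : ℤ) ^ (i + (j + 1)) • U i (j + 1 - 1)
        := by
    rw [← Finset.sum_sub_distrib]
    refine Finset.sum_congr rfl fun j hj => ?_
    obtain ⟨k, rfl⟩ := Nat.exists_eq_add_of_lt (Finset.mem_range.1 hj)
    rw [show j + k + 1 + 1 = (j + 1) + (k + 1) by ring, Finset.sum_range_add,
      show j + k + 1 - j = k + 1 by omega]
    rw [sub_eq_add_neg, ← Finset.sum_neg_distrib, add_comm]
    congr 1
    refine Finset.sum_congr rfl fun i hi => ?_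
    rw [← add_assoc i j 1, pow_succ]
    simp
  rw [hB]
  simp
  
/-- face map on vertices -/
def dl {n : ℕ} (i : ℕ) (k : Fin (n + 1)) : Fin (n + 2) :=
  ⟨if k.1 < i then k.1 else k.1 + 1, by split_ifs <;> omega⟩

/-- degeneracy map on vertices -/
def sg {n : ℕ} (j : ℕ) (k : Fin (n + 2)) : Fin (n + 1) :=
  ⟨min (if k.1 ≤ j then k.1 else k.1 - 1) n, by omega⟩

lemma sg_dl_lt {n i j : ℕ} (hij : i < j) (hj : j ≤ n + 1) (k : Fin (n + 2)) :
    sg (n := n + 1) j (dl i k) = dl i (sg (j - 1) k) := by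
  ext; simp only [dl, sg]; split_ifs <;> omega

lemma sg_dl_gt {n i j : ℕ} (hij : j + 1 < i) (hi : i ≤ n + 2) (k : Fin (n + 2)) :
    sg (n := n + 1) j (dl i k) = dl (i - 1) (sg j k) := by
  ext; simp only [dl, sg]; split_ifs <;> omega

lemma sg_dl_eq {n j : ℕ} (hj : j ≤ n) (k : Fin (n + 1)) :
    sg (n := n) j (dl j k) = k := by
  ext; simp only [dl, sg]; split_ifs <;> omega

lemma sg_dl_succ {n j : ℕ} (hj : j ≤ n) (k : Fin (n + 1)) :
    sg (n := n) j (dl (j + 1) k) = k := by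
  ext; simp only [dl, sg]; split_ifs <;> omega

section prism
variable {G H : Type} [Group G] [Group H]

lemma bd_single' (n : ℕ) (x : Smp G (n + 1)) (c : ℤ) :
    bd G n (Finsupp.single x c) =
      ∑ i ∈ Finset.range (n + 2), (-1 : ℤ) ^ i • Finsupp.single (Smp.pull (dl i) x) c := by
  rw [bd_single, Finset.sum_range]
  refine Finset.sum_congr rfl fun i _ => ?_
  congr 3
  funext k
  ext
  simp only [dl, Fin.succAbove, Fin.lt_def]
  split_ifs <;> simp_all

/-- the prism operator -/
noncomputable def prismOp (h : ∀ m, ℕ → Smp G m → Smp H (m + 1)) (n : ℕ) :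
    Ch G n →ₗ[ℤ] Ch H (n + 1) :=
  ∑ j ∈ Finset.range (n + 1), (-1 : ℤ) ^ j • Finsupp.lmapDomain ℤ ℤ (h n j)

lemma prismOp_single (h : ∀ m, ℕ → Smp G m → Smp H (m + 1)) (n : ℕ) (x : Smp G n) (c : ℤ) :
    prismOp h n (Finsupp.single x c) =
      ∑ j ∈ Finset.range (n + 1), (-1 : ℤ) ^ j • Finsupp.single (h n j x) c := by
  simp [prismOp, LinearMap.sum_apply, Finsupp.mapDomain_single]

lemma prism_lemma (h : ∀ m, ℕ → Smp G m → Smp H (m + 1)) (n : ℕ)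
    (N : Submodule ℤ (Ch H (n + 1))) (s : Set (Smp G (n + 1)))
    (f0 f1 : G →* H)
    (V : ℕ → Smp G (n + 1) → Smp H (n + 1))
    (hV0 : ∀ x, V 0 x = Smp.map f0 x) (hV1 : ∀ x, V (n + 2) x = Smp.map f1 x)
    (h1 : ∀ x i j, i < j → j ≤ n + 1 →
      Smp.pull (dl i) (h (n + 1) j x) = h n (j - 1) (Smp.pull (dl i) x))
    (h2 : ∀ x j, j ≤ n + 1 → Smp.pull (dl j) (h (n + 1) j x) = V j x)
    (h3 : ∀ x j, j ≤ n + 1 → Smp.pull (dl (j + 1)) (h (n + 1) j x) = V (j + 1) x)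
    (h4 : ∀ x ∈ s, ∀ i j, j + 1 < i → i ≤ n + 2 →
      Smp.pull (dl i) (h (n + 1) j x) = h n j (Smp.pull (dl (i - 1)) x) ∨
      (Finsupp.single (Smp.pull (dl i) (h (n + 1) j x)) 1 ∈ N ∧
        Finsupp.single (h n j (Smp.pull (dl (i - 1)) x)) 1 ∈ N))
    (z : Ch G (n + 1)) (hz : z ∈ Finsupp.supported ℤ ℤ s) (hbz : bd G n z = 0) :
    cm f0 _ z - cm f1 _ z - bd H (n + 1) (prismOp h (n + 1) z) ∈ N := by
  have key : bd H (n + 1) (prismOp h (n + 1) z) + prismOp h n (bd G n z) -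
      (cm f0 _ z - cm f1 _ z) ∈ N := by
    clear hbz
    rw [Finsupp.supported_eq_span_single] at hz
    induction hz using Submodule.span_induction with
    | zero => simp
    | add x y _ _ hx hy =>
      simp only [map_add]
      convert N.add_mem hx hy using 1
      abel
    | smul a x _ hx =>
      simp only [map_smul, ← smul_add, ← smul_sub]
      exact N.smul_mem _ hx
    | mem z hz =>
      obtain ⟨x, hx, rfl⟩ := hz
      simp only
      rw [← Submodule.Quotient.eq]
      have := prism_sum (n + 1) (fun i j => N.mkQ (Finsupp.single (Smp.pull (dl i) (h (n + 1) j x)) 1))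
        (fun i j => N.mkQ (Finsupp.single (h n j (Smp.pull (dl i) x)) 1))
        (fun j => N.mkQ (Finsupp.single (V j x) 1))
        (fun i j hij hj => by simp only [h1 x i j hij hj])
        (fun j hj => by simp only [h2 x j hj])
        (fun j hj => by simp only [h3 x j hj])
        (fun i j hij hi => by
          rcases h4 x hx i j hij hi with e | ⟨e, e'⟩
          · simp only [e]
          · simp only [Submodule.mkQ_apply]
            rw [(Submodule.Quotient.mk_eq_zero N).2 e, (Submodule.Quotient.mk_eq_zero N).2 e'])
      simp only [hV0, hV1] at this
      simp only [cm_single]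
      simp only [← Submodule.mkQ_apply]
      rw [map_sub, ← this, map_add]
      simp only [prismOp_single, bd_single', map_sum, map_smul, Finset.smul_sum, smul_smul,
        ← pow_add]
      congr 1
      · refine Finset.sum_congr rfl fun j _ => Finset.sum_congr rfl fun i _ => ?_
        rw [add_comm j i]
      · rw [Finset.sum_comm]
  rw [hbz, map_zero, add_zero] at key
  rw [← neg_mem_iff]
  convert key using 1
  abel

/-- boundaries -/
noncomputable abbrev Bd (G : Type) [Group G] (n : ℕ) : Submodule ℤ (Ch G n) := LinearMap.range (bd G n)

/-- conjugation prism -/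
def conjPrism (w : G) (m : ℕ) (j : ℕ) (x : Smp G m) : Smp G (m + 1) where
  g k l := (if k.1 ≤ j then 1 else w)⁻¹ * x.g (sg j k) (sg j l) * (if l.1 ≤ j then 1 else w)
  mul' i k l := by
    rw [← x.mul' (sg j i) (sg j k) (sg j l)]; group

lemma cm_conj (t : G) (n : ℕ) (z : Ch G (n + 1)) (hz : bd G n z = 0) :
    cm (MulAut.conj t).toMonoidHom _ z - z ∈ Bd G (n + 1) := by
  have := prism_lemma (conjPrism t⁻¹) n ⊥ Set.univ (MulAut.conj t).toMonoidHom (MonoidHom.id G)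
    (fun i x => { g := fun k l => (if k.1 < i then 1 else t⁻¹)⁻¹ * x.g k l *
                    (if l.1 < i then 1 else t⁻¹)
                  mul' := fun k l m => by rw [← x.mul' k l m]; group })
    (fun x => by ext; simp) (fun x => by ext k l; simp [k.2, l.2]) ?_ ?_ ?_ ?_ z (by simp) hz
  · rw [Submodule.mem_bot, cm_id, sub_eq_zero] at this
    rw [this]; exact ⟨_, rfl⟩
  · intro x i j hij hj
    ext k l
    have e : ∀ k : Fin (n + 2), ((dl i k).1 ≤ j) = (k.1 ≤ j - 1) := fun k => by
      simp only [dl, eq_iff_iff]; split_ifs <;> omega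
    simp only [conjPrism, Smp.pull_g, sg_dl_lt hij hj, e]
  · intro x j hj
    ext k l
    have e : ∀ k : Fin (n + 2), ((dl j k).1 ≤ j) = (k.1 < j) := fun k => by
      simp only [dl, eq_iff_iff]; split_ifs <;> omega
    simp only [conjPrism, Smp.pull_g, sg_dl_eq hj, e]
  · intro x j hj
    ext k l
    have e : ∀ k : Fin (n + 2), ((dl (j + 1) k).1 ≤ j) = (k.1 < j + 1) := fun k => by
      simp only [dl, eq_iff_iff]; split_ifs <;> omega
    simp only [conjPrism, Smp.pull_g, sg_dl_succ hj, e]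
  · intro x _ i j hij hi
    left
    ext k l
    have e : ∀ k : Fin (n + 2), ((dl i k).1 ≤ j) = (k.1 ≤ j) := fun k => by
      simp only [dl, eq_iff_iff]; split_ifs <;> omega
    simp only [conjPrism, Smp.pull_g, sg_dl_gt hij hi, e]

/-- Degenerate simplices. -/
def Deg (p : ℕ) {m : ℕ} (x : Smp G m) : Prop :=
  ∃ θ : Fin (m + 1) → ℕ, Monotone θ ∧ (∀ k, θ k ≤ p) ∧ ∀ k l, θ k = θ l → x.g k l = 1

/-- vertex map -/
def th {m : ℕ} (j : ℕ) (k : Fin (m + 2)) : Fin (m + 1) :=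
  ⟨if k.1 ≤ j then min k.1 m else m, by split_ifs <;> omega⟩

lemma th_dl_lt {n i j : ℕ} (hij : i < j) (hj : j ≤ n + 1) (k : Fin (n + 2)) :
    th (m := n + 1) j (dl i k) = dl i (th (j - 1) k) := by
  ext; simp only [dl, th]; split_ifs <;> omega

lemma th_dl_gt {n i j : ℕ} (hij : j + 1 < i) (hi : i ≤ n + 1) (k : Fin (n + 2)) :
    th (m := n + 1) j (dl i k) = dl (i - 1) (th j k) := by
  ext; simp only [dl, th]; split_ifs <;> omega

lemma monotone_sg {n : ℕ} (j : ℕ) : Monotone (sg (n := n) j) := by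
  intro a b hab
  have : a.1 ≤ b.1 := hab
  simp only [sg, Fin.le_def]; split_ifs <;> omega

lemma monotone_dl {n : ℕ} (j : ℕ) : Monotone (dl (n := n) j) := by
  intro a b hab
  have : a.1 ≤ b.1 := hab
  simp only [dl, Fin.le_def]; split_ifs <;> omega

/-- the shuffle prism -/
def shufPrism {L K : Type} [Group L] [Group K] (m : ℕ) (j : ℕ) (x : Smp (L × K) m) :
    Smp (L × (L × K)) (m + 1) where
  g k l := ((x.g (sg j k) (sg j l)).1, (x.g (th j k) (th j l)).1, (x.g (sg j k) (sg j l)).2)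
  mul' i k l := by
    simp only [Prod.mk_mul_mk, ← Prod.fst_mul, ← Prod.snd_mul, x.mul']

/-- the map `(l, k) ↦ (l, 1, k)` -/
def iotaHom (L K : Type) [Group L] [Group K] : L × K →* L × (L × K) where
  toFun x := (x.1, 1, x.2)
  map_one' := rfl
  map_mul' x y := by simp

/-- the map `(l, k) ↦ (l, l, k)` -/
def deltaHom (L K : Type) [Group L] [Group K] : L × K →* L × (L × K) where
  toFun x := (x.1, x.1, x.2)
  map_one' := rfl
  map_mul' x y := rfl

/-- chains whose first component has low degree -/
noncomputable def FDeg (L K : Type) [Group L] [Group K] (p m : ℕ) : Submodule ℤ (Ch (L × K) m) :=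
  Finsupp.supported ℤ ℤ {x | Deg p (Smp.map (MonoidHom.fst L K) x)}

lemma shuf_mem {L K : Type} [Group L] [Group K] (n p : ℕ) (z : Ch (L × K) (n + 1))
    (hz : z ∈ FDeg L K (p + 1) (n + 1)) (hbz : bd _ n z = 0) :
    cm (iotaHom L K) _ z - cm (deltaHom L K) _ z - bd _ (n + 1) (prismOp shufPrism (n + 1) z) ∈
      FDeg L (L × K) p (n + 1) := by
  refine prism_lemma shufPrism n (FDeg L (L × K) p (n + 1))
    {x | Deg (p + 1) (Smp.map (MonoidHom.fst L K) x)} (iotaHom L K) (deltaHom L K)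
    (fun j x => Smp.map (MonoidHom.id _) 
      { g := fun k l => ((x.g k l).1, (x.g (if k.1 < j then k else Fin.last _)
            (if l.1 < j then l else Fin.last _)).1, (x.g k l).2)
        mul' := fun k l m => by 
          simp only [Prod.mk_mul_mk, ← Prod.fst_mul, ← Prod.snd_mul, x.mul'] })
    ?_ ?_ ?_ ?_ ?_ ?_ z hz hbz
  · intro x
    ext k l
    · simp [iotaHom]
    · simp [iotaHom, x.self]
    · simp [iotaHom]
  · intro x
    ext k l
    · simp [deltaHom]
    · simp [deltaHom, k.2, l.2]
    · simp [deltaHom]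
  · intro x i j hij hj
    ext k l <;> simp [shufPrism, sg_dl_lt hij hj, th_dl_lt hij hj]
  · intro x j hj
    have e : ∀ k : Fin (n + 2), th j (dl j k) = (if k.1 < j then k else Fin.last _) := fun k => by
      ext; simp only [th, dl]; split_ifs <;> (try simp only [Fin.val_last]) <;> omega
    ext k l <;> simp [shufPrism, sg_dl_eq hj, e]
  · intro x j hj
    have e : ∀ k : Fin (n + 2), th j (dl (j + 1) k) = (if k.1 < j + 1 then k else Fin.last _) :=
      fun k => by
        ext; simp only [th, dl]; split_ifs <;> (try simp only [Fin.val_last]) <;> omega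
    ext k l <;> simp [shufPrism, sg_dl_succ hj, e]
  · rintro x ⟨θ, hmono, hle, h1⟩ i j hij hi
    rcases Nat.lt_or_ge i (n + 2) with hi' | hi'
    · left
      ext k l <;> simp [shufPrism, sg_dl_gt hij hi, th_dl_gt hij (Nat.lt_succ_iff.1 hi')]
    · obtain rfl : i = n + 2 := le_antisymm hi hi'
      by_cases hθ : θ ⟨n, by omega⟩ = θ (Fin.last (n + 1))
      · left
        have hone : (x.g ⟨n, by omega⟩ (Fin.last (n + 1))).1 = 1 := h1 _ _ hθ
        have hone' : (x.g (Fin.last (n + 1)) ⟨n, by omega⟩).1 = 1 := h1 _ _ hθ.symm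
        have e : ∀ k : Fin (n + 2), (x.g (th j (dl (n + 2) k)) (dl (n + 1) (th j k))).1 = 1 := by
          intro k
          by_cases hk : k.1 ≤ j
          · have : th (m := n + 1) j (dl (n + 2) k) = dl (n + 1) (th j k) := by
              ext; simp only [th, dl]; split_ifs <;> omega
            rw [this, x.self]; rfl
          · convert hone' using 3
            · ext; simp only [th, dl, Fin.last]; split_ifs <;> omega
            · ext; simp only [th, dl]; split_ifs <;> omega
        have e' : ∀ k : Fin (n + 2), (x.g (dl (n + 1) (th j k)) (th j (dl (n + 2) k))).1 = 1 := by
          intro k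
          have h := congrArg Prod.fst (x.mul' (dl (n + 1) (th j k)) (th j (dl (n + 2) k))
            (dl (n + 1) (th j k)))
          rw [Prod.fst_mul, e, x.self, mul_one] at h
          exact h
        ext k l
        · simp [shufPrism, sg_dl_gt hij hi]
        · simp only [shufPrism, Smp.pull_g, Nat.add_succ_sub_one]
          rw [← x.mul' _ (dl (n + 1) (th j k)), ← x.mul' _ (dl (n + 1) (th j l)) (th j _),
            Prod.fst_mul, Prod.fst_mul, e, e', one_mul, mul_one]
        · simp [shufPrism, sg_dl_gt hij hi]
      · right
        have hlt : θ ⟨n, by omega⟩ < θ (Fin.last (n + 1)) :=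
          lt_of_le_of_ne (hmono (Fin.le_last _)) hθ
        have hp := hle (Fin.last (n + 1))
        have hbound : ∀ k : Fin (n + 2), θ (dl (n + 1) (sg j k)) ≤ p := by
          intro k
          have : θ (dl (n + 1) (sg j k)) ≤ θ ⟨n, by omega⟩ := by
            apply hmono
            simp only [dl, sg, Fin.le_def]; split_ifs <;> omega
          omega
        have key : ∀ y : Smp (L × (L × K)) (n + 1), (∀ k l, (y.g k l).1 =
            (x.g (dl (n + 1) (sg j k)) (dl (n + 1) (sg j l))).1) →
            Finsupp.single y (1 : ℤ) ∈ FDeg L (L × K) p (n + 1) := by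
          intro y hy
          refine Finsupp.single_mem_supported ℤ (1 : ℤ) ?_
          refine ⟨fun k => θ (dl (n + 1) (sg j k)),
            hmono.comp ((monotone_dl _).comp (monotone_sg _)), hbound, ?_⟩
          intro k l hkl
          show (y.g k l).1 = 1
          rw [hy]
          exact h1 _ _ hkl
        constructor
        · apply key
          intro k l
          simp [shufPrism, sg_dl_gt hij hi]
        · apply key
          intro k l
          simp [shufPrism]

/-- the swindle property -/
def Swin {L : Type} [Group L] (ψ : L →* L) (n p : ℕ) : Prop :=
  ∀ (K : Type) [Group K] (z : Ch (L × K) (n + 1)), z ∈ FDeg L K p (n + 1) → bd _ n z = 0 →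
    cm (ψ.prodMap (MonoidHom.id K)) _ z - cm ((1 : L →* L).prodMap (MonoidHom.id K)) _ z ∈
      Bd (L × K) (n + 1)

lemma swin_zero {L : Type} [Group L] (ψ : L →* L) (n : ℕ) : Swin ψ n 0 := by
  intro K _ z hz hbz
  clear hbz
  have : cm (ψ.prodMap (MonoidHom.id K)) _ z = cm ((1 : L →* L).prodMap (MonoidHom.id K)) _ z := by
    rw [FDeg, Finsupp.supported_eq_span_single] at hz
    induction hz using Submodule.span_induction with
    | zero => simp
    | add x y _ _ hx hy => simp only [map_add, hx, hy]
    | smul a x _ hx => simp only [map_smul, hx]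
    | mem z hz =>
      obtain ⟨x, ⟨θ, _, hθ, h1⟩, rfl⟩ := hz
      simp only [cm_single]
      congr 1
      ext k l
      · have : (x.g k l).1 = 1 := h1 k l (by have := hθ k; have := hθ l; omega)
        simp [this]
      · simp
  rw [this, sub_self]
  exact zero_mem _

lemma cm_mem_Bd (f : G →* H) (n : ℕ) {z : Ch G n} (hz : z ∈ Bd G n) : cm f n z ∈ Bd H n := by
  obtain ⟨w, rfl⟩ := hz
  exact ⟨cm f _ w, (cm_bd f n w).symm⟩

lemma swin_add {L : Type} [Group L] (ψ α β γ : L →* L) (hc : ∀ x y, Commute (α x) (β y))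
    (hγ : ∀ x, γ x = α x * β x) (n p : ℕ)
    (h : Swin ψ n p) (K : Type) [Group K] (z : Ch (L × K) (n + 1))
    (hz : z ∈ FDeg L K (p + 1) (n + 1)) (hbz : bd _ n z = 0) :
    cm ((γ.comp ψ).prodMap (MonoidHom.id K)) _ z - cm ((α.comp ψ).prodMap (MonoidHom.id K)) _ z
    - cm ((β.comp ψ).prodMap (MonoidHom.id K)) _ z + cm ((1 : L →* L).prodMap (MonoidHom.id K)) _ z
      ∈ Bd (L × K) (n + 1) := by
  have h1 := shuf_mem n p z hz hbz
  have h2 := h (L × K) _ h1 (by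
    rw [map_sub, map_sub, bd_bd, ← cm_bd, ← cm_bd, hbz]; simp)
  let μ : L × (L × K) →* L × K :=
    { toFun := fun x => (α x.1 * β (ψ x.2.1), x.2.2)
      map_one' := by simp
      map_mul' := fun x y => by
        ext
        · simp only [Prod.fst_mul, Prod.snd_mul, map_mul]
          have := (hc y.1 (ψ x.2.1)).eq
          rw [mul_assoc, mul_assoc, ← mul_assoc (β _) (α _), ← this]
          simp only [mul_assoc]
        · simp }
  have h3 := cm_mem_Bd μ _ h2
  have hB : ∀ (f : L × (L × K) →* L × K) (w : Ch _ (n + 2)), cm f _ (bd _ (n + 1) w) ∈ Bd (L × K) (n + 1) :=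
    fun f w => cm_mem_Bd f _ ⟨w, rfl⟩
  simp only [map_sub, ← cm_comp] at h3
  have e1 : μ.comp ((ψ.prodMap (MonoidHom.id (L × K))).comp (iotaHom L K)) =
    (α.comp ψ).prodMap (MonoidHom.id K) := by ext <;> simp [μ, iotaHom]
  have e2 : μ.comp ((ψ.prodMap (MonoidHom.id (L × K))).comp (deltaHom L K)) =
    (γ.comp ψ).prodMap (MonoidHom.id K) := by ext <;> simp [μ, deltaHom, hγ]
  have e3 : μ.comp (((1 : L →* L).prodMap (MonoidHom.id (L × K))).comp (iotaHom L K)) =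
    (1 : L →* L).prodMap (MonoidHom.id K) := by ext <;> simp [μ, iotaHom]
  have e4 : μ.comp (((1 : L →* L).prodMap (MonoidHom.id (L × K))).comp (deltaHom L K)) =
    (β.comp ψ).prodMap (MonoidHom.id K) := by ext <;> simp [μ, deltaHom]
  rw [e1, e2, e3, e4] at h3
  have h4 := Submodule.add_mem _ h3 (Submodule.sub_mem _
    (hB (μ.comp (ψ.prodMap (MonoidHom.id (L × K)))) (prismOp shufPrism (n + 1) z))
    (hB (μ.comp ((1 : L →* L).prodMap (MonoidHom.id (L × K)))) (prismOp shufPrism (n + 1) z)))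
  rw [← neg_mem_iff]
  convert h4 using 1
  abel

lemma cm_conj_prod {L : Type} [Group L] (φ φ' : L →* L) (t : L) (h : ∀ x, φ' x = t * φ x * t⁻¹)
    (K : Type) [Group K] (n : ℕ) (z : Ch (L × K) (n + 1)) (hbz : bd _ n z = 0) :
    cm (φ'.prodMap (MonoidHom.id K)) _ z - cm (φ.prodMap (MonoidHom.id K)) _ z ∈
      Bd (L × K) (n + 1) := by
  have := cm_conj ((t, 1) : L × K) n (cm (φ.prodMap (MonoidHom.id K)) _ z) (by
    rw [← cm_bd, hbz, map_zero])
  rw [← cm_comp] at this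
  convert this using 4
  ext <;> simp [h]

lemma swin_step {L : Type} [Group L] (a a0 a1 b τ : L →* L) (t0 t1 s : L)
    (h0 : ∀ x, a0 x = t0 * a x * t0⁻¹) (h1 : ∀ x, a1 x = t1 * a x * t1⁻¹)
    (hb : ∀ x, b x = s * a x * s⁻¹)
    (ha : ∀ x, a x = a0 x * a1 x) (hτ : ∀ x, τ x = a x * b x)
    (hc : ∀ x y, Commute (a0 x) (a1 y)) (hc' : ∀ x y, Commute (a x) (b y))
    (ψ : L →* L) (n p : ℕ) (h : Swin ψ n p) : Swin (τ.comp ψ) n (p + 1) := by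
  intro K _ z hz hbz
  have k1 := swin_add ψ a0 a1 a hc ha n p h K z hz hbz
  have k2 := swin_add ψ a b τ hc' hτ n p h K z hz hbz
  have c0 := cm_conj_prod (a.comp ψ) (a0.comp ψ) t0 (fun x => h0 _) K n z hbz
  have c1 := cm_conj_prod (a.comp ψ) (a1.comp ψ) t1 (fun x => h1 _) K n z hbz
  have cb := cm_conj_prod (a.comp ψ) (b.comp ψ) s (fun x => hb _) K n z hbz
  clear hz hbz
  rw [← Submodule.Quotient.mk_eq_zero] at *
  simp only [Submodule.Quotient.mk_sub, Submodule.Quotient.mk_add] at *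
  generalize (Submodule.Quotient.mk (cm ((a.comp ψ).prodMap (MonoidHom.id K)) (n + 1) z) : _ ⧸ Bd (L × K) (n + 1)) = A at *
  generalize (Submodule.Quotient.mk (cm ((a0.comp ψ).prodMap (MonoidHom.id K)) (n + 1) z) : _ ⧸ Bd (L × K) (n + 1)) = A0 at *
  generalize (Submodule.Quotient.mk (cm ((a1.comp ψ).prodMap (MonoidHom.id K)) (n + 1) z) : _ ⧸ Bd (L × K) (n + 1)) = A1 at *
  generalize (Submodule.Quotient.mk (cm ((b.comp ψ).prodMap (MonoidHom.id K)) (n + 1) z) : _ ⧸ Bd (L × K) (n + 1)) = B at *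
  generalize (Submodule.Quotient.mk (cm ((τ.comp ψ).prodMap (MonoidHom.id K)) (n + 1) z) : _ ⧸ Bd (L × K) (n + 1)) = T at *
  generalize (Submodule.Quotient.mk (cm ((1 : L →* L).prodMap (MonoidHom.id K)) (n + 1) z) : _ ⧸ Bd (L × K) (n + 1)) = E at *
  obtain rfl := sub_eq_zero.1 c0
  obtain rfl := sub_eq_zero.1 c1
  obtain rfl := sub_eq_zero.1 cb
  have : T - E = (T - B - B + E) - (B - B - B + E) - (B - B - B + E) := by abel
  rw [this, k1, k2]; simp

lemma swin_pow {L : Type} [Group L] (a a0 a1 b τ : L →* L) (t0 t1 s : L)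
    (h0 : ∀ x, a0 x = t0 * a x * t0⁻¹) (h1 : ∀ x, a1 x = t1 * a x * t1⁻¹)
    (hb : ∀ x, b x = s * a x * s⁻¹)
    (ha : ∀ x, a x = a0 x * a1 x) (hτ : ∀ x, τ x = a x * b x)
    (hc : ∀ x y, Commute (a0 x) (a1 y)) (hc' : ∀ x y, Commute (a x) (b y))
    (K : Type) [Group K] (n : ℕ) (z : Ch (L × K) (n + 1)) (hbz : bd _ n z = 0) :
    cm (MonoidHom.prodMap ((show Monoid.End L from τ) ^ (n + 1) : Monoid.End L) (MonoidHom.id K)) _ z -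
      cm ((1 : L →* L).prodMap (MonoidHom.id K)) _ z ∈ Bd (L × K) (n + 1) := by
  have key : ∀ p, Swin ((show Monoid.End L from τ) ^ p : Monoid.End L) n p := by
    intro p
    induction p with
    | zero => exact swin_zero _ n
    | succ p ih =>
      rw [pow_succ']
      exact swin_step a a0 a1 b τ t0 t1 s h0 h1 hb ha hτ hc hc' _ n p ih
  refine key (n + 1) K z ?_ hbz
  intro x _
  exact ⟨fun k => k.1, fun a b h => h, fun k => Nat.lt_succ_iff.1 k.2, fun k l hkl => by
    rw [Fin.ext hkl]; exact Smp.self _ _⟩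

end prism


/-! ## Mapping telescopes of groups -/

/-- `U` is the colimit of `L → L → L → ⋯` along the injective map `τ`. -/
structure Tower (L : Type) [Group L] (τ : Monoid.End L) (U : Type) [Group U] where
  ι : ℕ → L →* U
  compat : ∀ k x, ι (k + 1) (τ x) = ι k x
  surj : ∀ u, ∃ k x, ι k x = u
  inj : ∀ k, Function.Injective (ι k)

lemma Tower.exists (L : Type) [Group L] (τ : Monoid.End L) (hτ : Function.Injective τ) :
    ∃ (U : Type) (_ : Group U), Nonempty (Tower L τ U) := by
  let f : ∀ i j : ℕ, i ≤ j → Monoid.End L := fun i j _ => τ ^ (j - i)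
  have : DirectedSystem (fun _ : ℕ => L) (fun i j h => ⇑(f i j h)) :=
    { map_self := fun {i} x => by simp [f]
      map_map := fun {k j i} hij hjk x => by
        show (τ ^ (k - j) * τ ^ (j - i)) x = (τ ^ (k - i)) x
        rw [← pow_add]; congr 2; omega }
  have hf : ∀ i j h, Function.Injective (f i j h) := by
    intro i j h
    show Function.Injective (τ ^ (j - i) : Monoid.End L)
    rw [Monoid.End.coe_pow]
    exact hτ.iterate _
  refine ⟨DirectLimit (fun _ : ℕ => L) f, inferInstance, ⟨⟨fun k =>
    { toFun := fun x => ⟦⟨k, x⟩⟧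
      map_one' := (DirectLimit.one_def k).symm
      map_mul' := fun x y => (DirectLimit.mul_def (f := f) k x y).symm }, ?_, ?_, ?_⟩⟩⟩
  · intro k x
    have := DirectLimit.mk_apply (f := f) k (k + 1) x (Nat.le_succ k)
    simpa [f] using this
  · intro u
    obtain ⟨k, x, h⟩ := DirectLimit.exists_eq_mk f u
    exact ⟨k, x, h.symm⟩
  · intro k
    exact DirectLimit.mk_injective f hf k

namespace Tower
variable {L U : Type} [Group L] [Group U] {τ : Monoid.End L} (T : Tower L τ U)

lemma compat_pow (k m : ℕ) (x : L) : T.ι (k + m) ((τ ^ m) x) = T.ι k x := by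
  induction m with
  | zero => simp
  | succ m ih =>
    rw [pow_succ', ← ih, ← add_assoc]
    exact T.compat _ _

lemma mem_range_mono {k l : ℕ} (h : k ≤ l) {u : U} (hu : u ∈ (T.ι k).range) : u ∈ (T.ι l).range := by
  obtain ⟨m, rfl⟩ := Nat.exists_eq_add_of_le h
  obtain ⟨x, rfl⟩ := hu
  exact ⟨_, T.compat_pow k m x⟩

end Tower

lemma Smp.lift_of_range {G H : Type} [Group G] [Group H] (f : G →* H) (hf : Function.Injective f)
    {n : ℕ} (x : Smp H n) (hx : ∀ i j, x.g i j ∈ f.range) : ∃ y : Smp G n, Smp.map f y = x := by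
  choose y hy using hx
  refine ⟨⟨y, fun i j k => hf ?_⟩, ?_⟩
  · rw [map_mul, hy, hy, hy, x.mul']
  · ext i j; exact hy i j

lemma Smp.map_injective {G H : Type} [Group G] [Group H] (f : G →* H) (hf : Function.Injective f)
    (n : ℕ) : Function.Injective (Smp.map f (n := n)) := by
  intro x y h
  ext i j
  exact hf (congrFun (congrFun (congrArg Smp.g h) i) j)

lemma cm_injective {G H : Type} [Group G] [Group H] (f : G →* H) (hf : Function.Injective f)
    (n : ℕ) : Function.Injective (cm f n) :=
  Finsupp.mapDomain_injective (Smp.map_injective f hf n)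

namespace Tower
variable {L U : Type} [Group L] [Group U] {τ : Monoid.End L} (T : Tower L τ U)

lemma prod_inj (K : Type) [Group K] (k : ℕ) :
    Function.Injective ((T.ι k).prodMap (MonoidHom.id K)) :=
  Function.Injective.prodMap (T.inj k) Function.injective_id

lemma lift_simplex (K : Type) [Group K] {n : ℕ} (x : Smp (U × K) n) :
    ∃ k, ∀ l, k ≤ l → ∃ y : Smp (L × K) n, Smp.map ((T.ι l).prodMap (MonoidHom.id K)) y = x := by
  have h : ∀ i j, ∃ k, (x.g i j).1 ∈ (T.ι k).range := by
    intro i j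
    obtain ⟨k, y, h⟩ := T.surj (x.g i j).1
    exact ⟨k, y, h⟩
  choose k hk using h
  refine ⟨∑ i, ∑ j, k i j, fun l hl => Smp.lift_of_range _ (T.prod_inj K l) _ ?_⟩
  intro i j
  have h1 : k i j ≤ l := by
    refine le_trans ?_ hl
    refine le_trans (Finset.single_le_sum (f := fun j => k i j) (fun _ _ => Nat.zero_le _)
      (Finset.mem_univ j)) ?_
    exact Finset.single_le_sum (f := fun i => ∑ j, k i j) (fun _ _ => Nat.zero_le _)
      (Finset.mem_univ i)
  obtain ⟨y, hy⟩ := T.mem_range_mono h1 (hk i j)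
  exact ⟨(y, (x.g i j).2), Prod.ext hy rfl⟩

lemma lift_chain (K : Type) [Group K] {n : ℕ} (z : Ch (U × K) n) :
    ∃ k, ∀ l, k ≤ l → ∃ y, cm ((T.ι l).prodMap (MonoidHom.id K)) n y = z := by
  induction z using Finsupp.induction_linear with
  | zero => exact ⟨0, fun l _ => ⟨0, by simp⟩⟩
  | add f g hf hg =>
    obtain ⟨k, hk⟩ := hf
    obtain ⟨k', hk'⟩ := hg
    refine ⟨max k k', fun l hl => ?_⟩
    obtain ⟨y, hy⟩ := hk l (le_trans (le_max_left _ _) hl)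
    obtain ⟨y', hy'⟩ := hk' l (le_trans (le_max_right _ _) hl)
    exact ⟨y + y', by rw [map_add, hy, hy']⟩
  | single x c =>
    obtain ⟨k, hk⟩ := T.lift_simplex K x
    refine ⟨k, fun l hl => ?_⟩
    obtain ⟨y, hy⟩ := hk l hl
    exact ⟨Finsupp.single y c, by rw [cm_single, hy]⟩

/-- The swindle hypothesis for `τ`. -/
def _root_.IsSwindle {L : Type} [Group L] (τ : Monoid.End L) : Prop :=
  ∀ (K : Type) [Group K] (n : ℕ) (z : Ch (L × K) (n + 1)), bd _ n z = 0 →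
    cm (MonoidHom.prodMap (τ ^ (n + 1) : Monoid.End L) (MonoidHom.id K)) _ z -
      cm ((1 : L →* L).prodMap (MonoidHom.id K)) _ z ∈ Bd (L × K) (n + 1)

lemma acyclic (T : Tower L τ U) (hτ : IsSwindle τ) (K : Type) [Group K] (n : ℕ) (z : Ch (U × K) (n + 1))
    (hz : bd _ n z = 0) :
    z - cm ((1 : U →* U).prodMap (MonoidHom.id K)) _ z ∈ Bd (U × K) (n + 1) := by
  obtain ⟨k, hk⟩ := T.lift_chain K z
  obtain ⟨y, rfl⟩ := hk k le_rfl
  have hy : bd _ n y = 0 := by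
    apply cm_injective _ (T.prod_inj K k)
    rw [cm_bd, hz, map_zero]
  have h := cm_mem_Bd ((T.ι (k + (n + 1))).prodMap (MonoidHom.id K)) _ (hτ K n y hy)
  rw [map_sub, ← cm_comp, ← cm_comp] at h
  rw [← cm_comp]
  convert h using 3
  · congr 1
    ext x
    · exact (T.compat_pow k (n + 1) x.1).symm
    · rfl
  · congr 1
    ext <;> simp

end Tower

section PHmap
variable {G H : Type} [Group G] [Group H]

/-- The map induced on homology. -/
noncomputable def phMap (f : G →* H) (n : ℕ) : PH G n →ₗ[ℤ] PH H n :=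
  Submodule.mapQ _ _ ((cm f (n + 1)).restrict (p := LinearMap.ker (bd G n))
    (q := LinearMap.ker (bd H n)) (fun x hx => by
      rw [LinearMap.mem_ker] at hx ⊢
      rw [← cm_bd, hx, map_zero])) (by
    intro x hx
    exact cm_mem_Bd f _ hx)

lemma phMap_mk (f : G →* H) (n : ℕ) (z : Ch G (n + 1)) (hz : z ∈ LinearMap.ker (bd G n)) :
    phMap f n (Submodule.Quotient.mk ⟨z, hz⟩) = Submodule.Quotient.mk ⟨cm f _ z, by
      rw [LinearMap.mem_ker] at hz ⊢
      rw [← cm_bd, hz, map_zero]⟩ := rfl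

lemma ph_eq_iff (n : ℕ) (z z' : Ch G (n + 1)) (hz : z ∈ LinearMap.ker (bd G n))
    (hz' : z' ∈ LinearMap.ker (bd G n)) :
    (Submodule.Quotient.mk ⟨z, hz⟩ : PH G n) = Submodule.Quotient.mk ⟨z', hz'⟩ ↔
      z - z' ∈ Bd G (n + 1) := by
  rw [Submodule.Quotient.eq]; rfl

lemma phMap_comp {K : Type} [Group K] (f : G →* H) (g : H →* K) (n : ℕ) (c : PH G n) :
    phMap g n (phMap f n c) = phMap (g.comp f) n c := by
  obtain ⟨⟨z, hz⟩, rfl⟩ := Submodule.Quotient.mk_surjective _ c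
  rw [phMap_mk, phMap_mk, phMap_mk]
  simp only [cm_comp]

lemma phMap_id (n : ℕ) (c : PH G n) : phMap (MonoidHom.id G) n c = c := by
  obtain ⟨⟨z, hz⟩, rfl⟩ := Submodule.Quotient.mk_surjective _ c
  rw [phMap_mk]
  simp only [cm_id]

lemma ph_equiv_of_mulEquiv (e : G ≃* H) (n : ℕ) : Nonempty (PH G n ≃+ PH H n) :=
  ⟨{ (phMap e.toMonoidHom n).toAddMonoidHom with
      invFun := phMap e.symm.toMonoidHom n
      left_inv := fun c => by
        show phMap _ n (phMap _ n c) = c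
        rw [phMap_comp]
        convert phMap_id n c
        ext; simp
      right_inv := fun c => by
        show phMap _ n (phMap _ n c) = c
        rw [phMap_comp]
        convert phMap_id n c
        ext; simp }⟩

lemma ph_subsingleton_of_subsingleton [Subsingleton G] (n : ℕ) : Subsingleton (PH G n) := by
  obtain ⟨e⟩ := groupHomology_equiv G n
  have := ModuleCat.subsingleton_of_isZero
    (isZero_groupHomology_succ_of_subsingleton (Rep.trivial ℤ G ℤ) n)
  exact e.symm.toEquiv.subsingleton

end PHmap

namespace Tower
variable {L U : Type} [Group L] [Group U] {τ : Monoid.End L} (T : Tower L τ U)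

lemma ph_prod (T : Tower L τ U) (hτ : IsSwindle τ) (K : Type) [Group K] (n : ℕ) :
    Nonempty (PH (U × K) n ≃+ PH K n) :=
  ⟨{ (phMap (MonoidHom.snd U K) n).toAddMonoidHom with
      invFun := phMap (MonoidHom.inr U K) n
      left_inv := fun c => by
        show phMap _ n (phMap _ n c) = c
        rw [phMap_comp]
        obtain ⟨⟨z, hz⟩, rfl⟩ := Submodule.Quotient.mk_surjective _ c
        rw [phMap_mk, ph_eq_iff, ← neg_mem_iff, neg_sub]
        exact T.acyclic hτ K n z hz
      right_inv := fun c => by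
        show phMap _ n (phMap _ n c) = c
        rw [phMap_comp]
        convert phMap_id n c
        ext; rfl }⟩

lemma ph_zero (T : Tower L τ U) (hτ : IsSwindle τ) (n : ℕ) : Subsingleton (PH U n) := by
  obtain ⟨e⟩ := T.ph_prod hτ PUnit n
  obtain ⟨e'⟩ := ph_equiv_of_mulEquiv (MulEquiv.prodUnique : U × PUnit ≃* U) n
  have := ph_subsingleton_of_subsingleton (G := PUnit) n
  exact (e'.symm.trans e).toEquiv.subsingleton

end Tower


/-! ## Wreath type permutation groups -/

/-- Permutations of `A × X` commuting with left translation by `A`. -/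
def Wr (A X : Type) [CommGroup A] : Subgroup (Equiv.Perm (A × X)) where
  carrier := {σ | ∀ c a x, σ (c * a, x) = (c * (σ (a, x)).1, (σ (a, x)).2)}
  one_mem' := fun c a x => rfl
  mul_mem' := by
    intro σ ρ hσ hρ c a x
    show σ (ρ _) = (c * (σ (ρ _)).1, (σ (ρ _)).2)
    rw [hρ, hσ]
  inv_mem' := by
    intro σ hσ c a x
    rw [Equiv.Perm.inv_eq_iff_eq, hσ]
    simp

namespace Wr
variable {A X Y J : Type} [CommGroup A]

lemma equivar (σ : Wr A X) (c a : A) (x : X) :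
    σ.1 (c * a, x) = (c * (σ.1 (a, x)).1, (σ.1 (a, x)).2) := σ.2 c a x

lemma mul_apply' (σ ρ : Wr A X) (p : A × X) : (σ * ρ).1 p = σ.1 (ρ.1 p) := rfl

/-- the embedding of points -/
def kap (A : Type) (i : X × J ↪ Y) : (A × X) × J ↪ A × Y where
  toFun p := (p.1.1, i (p.1.2, p.2))
  inj' := by
    rintro ⟨⟨a, x⟩, j⟩ ⟨⟨a', x'⟩, j'⟩ h
    simp only [Prod.mk.injEq, EmbeddingLike.apply_eq_iff_eq] at h ⊢
    tauto

/-- auxiliary permutation -/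
noncomputable def Faux (i : X × J ↪ Y) (σ : Equiv.Perm (A × X)) : Equiv.Perm (A × Y) :=
  Equiv.Perm.viaEmbedding (Equiv.prodCongr σ (Equiv.refl J)) (kap A i)

lemma Faux_apply (i : X × J ↪ Y) (σ : Equiv.Perm (A × X)) (a : A) (x : X) (j : J) :
    Faux i σ (a, i (x, j)) = ((σ (a, x)).1, i ((σ (a, x)).2, j)) :=
  Equiv.Perm.viaEmbedding_apply (Equiv.prodCongr σ (Equiv.refl J)) (kap A i) ((a, x), j)

lemma Faux_apply_of_not (i : X × J ↪ Y) (σ : Equiv.Perm (A × X)) (a : A) (y : Y)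
    (hy : ∀ p, i p ≠ y) : Faux i σ (a, y) = (a, y) := by
  refine Equiv.Perm.viaEmbedding_apply_of_notMem _ _ _ ?_
  rintro ⟨⟨⟨a', x⟩, j⟩, h⟩
  exact hy _ (congrArg Prod.snd h)

lemma cases_range (i : X × J ↪ Y) (y : Y) : (∃ x j, y = i (x, j)) ∨ ∀ p, i p ≠ y := by
  by_cases h : ∃ x j, y = i (x, j)
  · exact Or.inl h
  · right
    rintro ⟨x, j⟩ h'
    exact h ⟨x, j, h'.symm⟩

/-- The amplification homomorphism. -/
noncomputable def F (i : X × J ↪ Y) : Wr A X →* Wr A Y where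
  toFun σ := ⟨Faux i σ.1, by
    intro c a y
    rcases cases_range i y with ⟨x, j, rfl⟩ | h
    · rw [Faux_apply, Faux_apply, equivar]
    · rw [Faux_apply_of_not i _ _ _ h, Faux_apply_of_not i _ _ _ h]⟩
  map_one' := by
    apply Subtype.ext
    refine Equiv.ext ?_
    rintro ⟨a, y⟩
    rcases cases_range i y with ⟨x, j, rfl⟩ | h
    · exact Faux_apply i _ _ _ _
    · exact Faux_apply_of_not i _ _ _ h
  map_mul' σ ρ := by
    apply Subtype.ext
    refine Equiv.ext ?_
    rintro ⟨a, y⟩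
    show Faux i _ _ = Faux i _ (Faux i _ _)
    rcases cases_range i y with ⟨x, j, rfl⟩ | h
    · rw [Faux_apply, Faux_apply, Faux_apply]; rfl
    · rw [Faux_apply_of_not i _ _ _ h, Faux_apply_of_not i _ _ _ h, Faux_apply_of_not i _ _ _ h]

lemma F_apply (i : X × J ↪ Y) (σ : Wr A X) (a : A) (x : X) (j : J) :
    (F i σ).1 (a, i (x, j)) = ((σ.1 (a, x)).1, i ((σ.1 (a, x)).2, j)) := Faux_apply i _ _ _ _

lemma F_apply_of_not (i : X × J ↪ Y) (σ : Wr A X) (a : A) (y : Y)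
    (hy : ∀ p, i p ≠ y) : (F i σ).1 (a, y) = (a, y) := Faux_apply_of_not i _ _ _ hy

lemma F_unique (i : X × J ↪ Y) (σ : Wr A X) (ρ : Wr A Y)
    (h1 : ∀ a x j, ρ.1 (a, i (x, j)) = ((σ.1 (a, x)).1, i ((σ.1 (a, x)).2, j)))
    (h2 : ∀ a y, (∀ p, i p ≠ y) → ρ.1 (a, y) = (a, y)) : F i σ = ρ := by
  apply Subtype.ext
  refine Equiv.ext ?_
  rintro ⟨a, y⟩
  rcases cases_range i y with ⟨x, j, rfl⟩ | h
  · rw [F_apply, h1]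
  · rw [F_apply_of_not i _ _ _ h, h2 _ _ h]

lemma F_injective (i : X × J ↪ Y) [Nonempty J] : Function.Injective (F (A := A) i) := by
  intro σ ρ h
  apply Subtype.ext
  refine Equiv.ext ?_
  rintro ⟨a, x⟩
  obtain ⟨j⟩ := ‹Nonempty J›
  have h1 := F_apply i σ a x j
  rw [h, F_apply] at h1
  simp only [Prod.mk.injEq, EmbeddingLike.apply_eq_iff_eq, and_true] at h1
  exact (Prod.ext h1.1 h1.2).symm

/-- Lift of plain permutations. -/
def P (A : Type) [CommGroup A] (X : Type) : Equiv.Perm X →* Wr A X where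
  toFun π := ⟨Equiv.prodCongr (Equiv.refl A) π, fun _ _ _ => rfl⟩
  map_one' := rfl
  map_mul' _ _ := rfl

lemma P_apply (π : Equiv.Perm X) (a : A) (x : X) : (P A X π).1 (a, x) = (a, π x) := rfl

lemma P_injective : Function.Injective (P A X) := by
  intro π ρ h
  ext x
  have : (P A X π).1 (1, x) = (P A X ρ).1 (1, x) := by rw [h]
  exact congrArg Prod.snd this

lemma F_conj {J' : Type} (i : X × J ↪ Y) (i' : X × J' ↪ Y) (r : J ≃ J') (π : Equiv.Perm Y)
    (h : ∀ x j, π (i (x, j)) = i' (x, r j)) (σ : Wr A X) :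
    F i' σ = P A Y π * F i σ * (P A Y π)⁻¹ := by
  rw [← map_inv]
  apply F_unique
  · intro a x j
    have : π⁻¹ (i' (x, j)) = i (x, r.symm j) := by
      rw [Equiv.Perm.inv_eq_iff_eq, h]; simp
    rw [mul_apply', mul_apply', P_apply π⁻¹ a (i' (x, j)), this, F_apply, P_apply, h]; simp
  · intro a y hy
    rw [mul_apply', mul_apply', P_apply π⁻¹ a y, F_apply_of_not, P_apply]
    · simp
    · rintro ⟨x, j⟩ hp
      refine hy (x, r j) ?_
      rw [← h, hp]; simp

/-- The complement of the range is large. -/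
def Big (i : X × J ↪ Y) : Prop := ∃ f : Y → Y, Function.Injective f ∧ ∀ y p, i p ≠ f y

lemma Big.equiv {i : X × J ↪ Y} (h : Big i) : Nonempty (((Set.range i)ᶜ : Set Y) ≃ Y) := by
  obtain ⟨f, hf, h⟩ := h
  obtain ⟨g, hg⟩ := Function.Embedding.schroeder_bernstein
    (f := (Subtype.val : ((Set.range i)ᶜ : Set Y) → Y))
    (g := fun y => ⟨f y, by rintro ⟨p, hp⟩; exact h y p hp⟩) Subtype.val_injective
    (fun a b hab => hf (congrArg Subtype.val hab))
  exact ⟨Equiv.ofBijective g hg⟩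

lemma exists_conj {J' : Type} {i : X × J ↪ Y} {i' : X × J' ↪ Y} (r : J ≃ J') (h : Big i)
    (h' : Big i') : ∃ t : Wr A Y, ∀ σ : Wr A X, F i' σ = t * F i σ * t⁻¹ := by
  classical
  obtain ⟨c⟩ := h.equiv
  obtain ⟨c'⟩ := h'.equiv
  let q : Set.range i ≃ Set.range i' :=
    ((Equiv.ofInjective i i.injective).symm.trans (Equiv.prodCongr (Equiv.refl X) r)).trans
      (Equiv.ofInjective i' i'.injective)
  let π : Equiv.Perm Y := (Equiv.Set.sumCompl (Set.range i)).symm.trans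
    ((Equiv.sumCongr q (c.trans c'.symm)).trans (Equiv.Set.sumCompl (Set.range i')))
  refine ⟨P A Y π, F_conj i i' r π ?_⟩
  intro x j
  have h1 : (Equiv.Set.sumCompl (Set.range i)).symm (i (x, j)) = Sum.inl ⟨i (x, j), ⟨_, rfl⟩⟩ :=
    Equiv.Set.sumCompl_symm_apply_of_mem (s := Set.range i) (Set.mem_range_self (x, j))
  have h2 : (Equiv.ofInjective i i.injective).symm ⟨i (x, j), ⟨_, rfl⟩⟩ = (x, j) :=
    Equiv.ofInjective_symm_apply i.injective (x, j)
  simp only [π, Equiv.trans_apply, h1, Equiv.sumCongr_apply, Sum.map_inl, q,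
    Equiv.Set.sumCompl_apply_inl, h2]
  rfl

/-- even half -/
def half0 (i : X × ℕ ↪ Y) : X × ℕ ↪ Y where
  toFun p := i (p.1, 2 * p.2)
  inj' := by
    rintro ⟨x, n⟩ ⟨x', n'⟩ h
    have := i.injective h
    simp only [Prod.mk.injEq] at this ⊢
    exact ⟨this.1, by omega⟩

/-- odd half -/
def half1 (i : X × ℕ ↪ Y) : X × ℕ ↪ Y where
  toFun p := i (p.1, 2 * p.2 + 1)
  inj' := by
    rintro ⟨x, n⟩ ⟨x', n'⟩ h
    have := i.injective h
    simp only [Prod.mk.injEq] at this ⊢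
    exact ⟨this.1, by omega⟩

lemma half_ne (i : X × ℕ ↪ Y) (p q) : half0 i p ≠ half1 i q := by
  intro h
  have := i.injective h
  simp only [Prod.mk.injEq] at this
  omega

lemma big_half0 (i : X × ℕ ↪ X) : Big (half0 i) :=
  ⟨fun x => half1 i (x, 0), fun x y h => by simpa using h, fun y p => half_ne i _ _⟩

lemma big_half1 (i : X × ℕ ↪ X) : Big (half1 i) :=
  ⟨fun x => half0 i (x, 0), fun x y h => by simpa using h, fun y p => (half_ne i _ _).symm⟩

lemma F_half (i : X × ℕ ↪ Y) (σ : Wr A X) : F i σ = F (half0 i) σ * F (half1 i) σ := by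
  apply F_unique
  · intro a x j
    rw [mul_apply']
    rcases Nat.even_or_odd' j with ⟨c, rfl | rfl⟩
    · have e : ∀ x, i (x, 2 * c) = half0 i (x, c) := fun x => rfl
      rw [e, F_apply_of_not _ _ _ _ (fun p => (half_ne i _ _).symm), F_apply]
      rfl
    · have e : ∀ x, i (x, 2 * c + 1) = half1 i (x, c) := fun x => rfl
      rw [e, F_apply, F_apply_of_not _ _ _ _ (fun p => (half_ne i _ _))]
      rfl
  · intro a y hy
    rw [mul_apply', F_apply_of_not (half1 i) σ a y (fun p => hy _),
      F_apply_of_not (half0 i) σ a y (fun p => hy _)]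

lemma F_commute {X' J' : Type} (i : X × J ↪ Y) (i' : X' × J' ↪ Y) (h : ∀ p q, i p ≠ i' q)
    (σ : Wr A X) (ρ : Wr A X') : Commute (F i σ) (F i' ρ) := by
  apply Subtype.ext
  refine Equiv.Perm.Disjoint.commute ?_
  rintro ⟨a, y⟩
  rcases cases_range i y with ⟨x, j, rfl⟩ | h'
  · right; exact F_apply_of_not _ _ _ _ (fun p => (h _ _).symm)
  · left; exact F_apply_of_not _ _ _ _ h'

/-- composite embedding -/
def compEmb {Z J' : Type} (k : X × J ↪ Y) (i : Y × J' ↪ Z) : X × (J × J') ↪ Z where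
  toFun p := i (k (p.1, p.2.1), p.2.2)
  inj' := by
    rintro ⟨x, n, m⟩ ⟨x', n', m'⟩ h
    have h1 := i.injective h
    simp only [Prod.mk.injEq, EmbeddingLike.apply_eq_iff_eq] at h1 ⊢
    tauto

lemma F_comp {Z J' : Type} (k : X × J ↪ Y) (i : Y × J' ↪ Z) (σ : Wr A X) :
    F (compEmb k i) σ = F i (F k σ) := by
  apply F_unique
  · rintro a x ⟨j, j'⟩
    show (F i (F k σ)).1 (a, i (k (x, j), j')) = _
    rw [F_apply, F_apply]; rfl
  · intro a z hz
    rcases cases_range i z with ⟨y, j, rfl⟩ | h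
    · rw [F_apply, F_apply_of_not]
      rintro ⟨x, j'⟩ hp
      exact hz (x, (j', j)) (by rw [← hp]; rfl)
    · exact F_apply_of_not _ _ _ _ h

section tau
variable (e : X × ℕ ≃ X)

/-- the swindle endomorphism -/
noncomputable def tau (A : Type) [CommGroup A] : Monoid.End (Wr A X) := F e.toEmbedding

lemma tau_injective : Function.Injective (tau e A) := F_injective e.toEmbedding

lemma tau_swindle : IsSwindle (tau e A) := by
  set i := e.toEmbedding
  obtain ⟨t0, h0⟩ := exists_conj (A := A) (Equiv.refl ℕ) (big_half0 i) (big_half0 (half0 i))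
  obtain ⟨t1, h1⟩ := exists_conj (A := A) (Equiv.refl ℕ) (big_half0 i) (big_half1 (half0 i))
  obtain ⟨s, hs⟩ := exists_conj (A := A) (Equiv.refl ℕ) (big_half0 i) (big_half1 i)
  intro K _ n z hz
  exact swin_pow (F (half0 i)) (F (half0 (half0 i))) (F (half1 (half0 i))) (F (half1 i)) (F i)
    t0 t1 s h0 h1 hs (F_half _) (F_half _) (F_commute _ _ (half_ne _)) (F_commute _ _ (half_ne _))
    K n z hz

/-- `g` moves a large set off itself. -/
def Mv (g : Wr A X) : Prop :=
  ∃ f : X ↪ X, ∀ a x x', (g.1 (a, f x)).2 ≠ f x'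

lemma Mv.tau {g : Wr A X} (h : Mv g) : Mv (tau e A g) := by
  obtain ⟨f, hf⟩ := h
  refine ⟨⟨fun x => e (f (e.symm x).1, (e.symm x).2), fun x y hxy => ?_⟩, ?_⟩
  · have := e.injective hxy
    simp only [Prod.mk.injEq, EmbeddingLike.apply_eq_iff_eq] at this
    exact e.symm.injective (Prod.ext this.1 this.2)
  · intro a x x' h
    have h1 : ((Wr.tau e A g).1 (a, e (f (e.symm x).1, (e.symm x).2))).2 = _ :=
      congrArg Prod.snd (F_apply e.toEmbedding g a (f (e.symm x).1) (e.symm x).2)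
    have h2 := h1.symm.trans h
    have h3 := e.injective h2
    exact hf _ _ _ (congrArg Prod.fst h3)

lemma tau_mem_of_Mv (N : Subgroup (Wr A X)) [N.Normal] {g : Wr A X} (hg : g ∈ N) (h : Mv g)
    (σ : Wr A X) : tau e A σ ∈ N := by
  obtain ⟨f, hf⟩ := h
  let fe : X × Unit ↪ X := ⟨fun p => f p.1, fun p q h => Prod.ext (f.injective h) rfl⟩
  have hcomm : ∀ h h' : Wr A X, Commute (g * F fe h * g⁻¹) (F fe h') := by
    intro h h'
    apply Subtype.ext
    refine Equiv.Perm.Disjoint.commute ?_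
    rintro ⟨a, y⟩
    rcases cases_range fe y with ⟨x, j, rfl⟩ | h'
    · left
      show g.1 ((F fe h).1 (g.1⁻¹ _)) = _
      rcases hp : g.1⁻¹ (a, fe (x, j)) with ⟨b, w⟩
      rw [F_apply_of_not, ← hp]
      · simp
      · rintro ⟨x', j'⟩ rfl
        rw [Equiv.Perm.inv_eq_iff_eq] at hp
        exact hf b x' x (congrArg Prod.snd hp).symm
    · right; exact F_apply_of_not _ _ _ _ h'
  have key : ∀ h h' : Wr A X, F fe (h' * h⁻¹ * h'⁻¹ * h) ∈ N := by
    intro h h'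
    have n1 : g * F fe h * g⁻¹ * (F fe h)⁻¹ ∈ N := by
      have := N.mul_mem hg (‹N.Normal›.conj_mem _ (N.inv_mem hg) (F fe h))
      convert this using 1; group
    have n2 := N.mul_mem (‹N.Normal›.conj_mem _ n1 (F fe h')) (N.inv_mem n1)
    have c1 := (hcomm h h').eq
    generalize g * F fe h * g⁻¹ = c at *
    have n3 := ‹N.Normal›.conj_mem _ n2 c⁻¹
    convert n3 using 1
    simp only [map_mul, map_inv]
    have c2 : F fe h' * c = c * F fe h' := c1.symm
    rw [show c⁻¹ * (F fe h' * (c * (F fe h)⁻¹) * (F fe h')⁻¹ * (c * (F fe h)⁻¹)⁻¹) * c⁻¹⁻¹ =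
      c⁻¹ * (F fe h' * c) * (F fe h)⁻¹ * (F fe h')⁻¹ * F fe h by group, c2]
    group
  set i := e.toEmbedding
  obtain ⟨t1, h1⟩ := exists_conj (A := A) (Equiv.refl ℕ) (big_half0 i) (big_half1 (half0 i))
  have m0 : F (compEmb (half0 (half0 i)) fe) σ ∈ N := by
    rw [F_comp]
    have h2 := F_half (half0 i) σ
    rw [h1] at h2
    have h3 : F (half0 (half0 i)) σ = F (half0 i) σ * t1 * (F (half0 i) σ)⁻¹ * t1⁻¹ := by
      have := eq_mul_inv_of_mul_eq h2.symm
      rw [this]; group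
    rw [h3]
    have := key t1⁻¹ (F (half0 i) σ)
    rwa [inv_inv] at this
  have hbig : Big (compEmb (half0 (half0 i)) fe) := by
    refine ⟨fun x => f (half1 i (x, 0)), fun x y h => by simpa using h, ?_⟩
    rintro y ⟨x, j, u⟩ h
    exact half_ne i _ _ (f.injective h)
  have ma : ∀ k : X × ℕ ↪ X, Big k → F k σ ∈ N := by
    intro k hk
    obtain ⟨t, ht⟩ := exists_conj (A := A) (Equiv.prodUnique ℕ Unit) hbig hk
    rw [ht]
    exact ‹N.Normal›.conj_mem _ m0 t
  show F i σ ∈ N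
  rw [F_half]
  exact N.mul_mem (ma _ (big_half0 i)) (ma _ (big_half1 i))

end tau
end Wr


/-! ## The acyclic groups -/

namespace Wr
variable {A X : Type} [CommGroup A] (e : X × ℕ ≃ X)

lemma mv_tau_pow {g : Wr A X} (h : Mv g) (k : ℕ) : Mv ((tau e A ^ k) g) := by
  induction k with
  | zero => exact h
  | succ k ih =>
    rw [pow_succ']
    exact Mv.tau e ih

lemma tower_normalClosure {U : Type} [Group U] (T : Tower (Wr A X) (tau e A) U) {g : Wr A X}
    (hg : Mv g) : Subgroup.normalClosure {T.ι 0 g} = ⊤ := by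
  rw [eq_top_iff]
  intro u _
  obtain ⟨k, σ, rfl⟩ := T.surj u
  set N := Subgroup.normalClosure {T.ι 0 g}
  have h1 : (tau e A ^ (k + 1)) g ∈ N.comap (T.ι (k + 1)) := by
    rw [Subgroup.mem_comap]
    have := T.compat_pow 0 (k + 1) g
    rw [zero_add] at this
    rw [this]
    exact Subgroup.subset_normalClosure rfl
  have h2 := tau_mem_of_Mv e (N.comap (T.ι (k + 1))) h1 (mv_tau_pow e hg (k + 1)) σ
  rw [Subgroup.mem_comap, T.compat] at h2
  exact h2

/-- Permutation action of `Γ` on `X ≃ Γ × X`. -/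
def regPerm {Γ : Type} [Group Γ] (q : X ≃ Γ × X) : Γ →* Equiv.Perm X where
  toFun γ := q.trans ((Equiv.prodCongr (Equiv.mulLeft γ) (Equiv.refl X)).trans q.symm)
  map_one' := by ext x; simp
  map_mul' a b := by
    ext x
    apply q.injective
    refine Prod.ext ?_ ?_ <;> simp [mul_assoc]

/-- The regular embedding. -/
def reg (A : Type) [CommGroup A] {Γ : Type} [Group Γ] (q : X ≃ Γ × X) : Γ →* Wr A X :=
  (P A X).comp (regPerm q)

lemma reg_apply {Γ : Type} [Group Γ] (q : X ≃ Γ × X) (γ δ : Γ) (a : A) (x : X) :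
    (reg A q γ).1 (a, q.symm (δ, x)) = (a, q.symm (γ * δ, x)) := by
  show (a, regPerm q γ _) = _
  simp [regPerm]

lemma reg_mv {Γ : Type} [Group Γ] (q : X ≃ Γ × X) {γ : Γ} (h : γ ≠ 1) : Mv (reg A q γ) := by
  refine ⟨⟨fun x => q.symm (1, x), fun x y h => by simpa using h⟩, ?_⟩
  intro a x x' h'
  have h1 := congrArg Prod.snd (reg_apply (A := A) q γ 1 a x)
  have h2 := q.symm.injective (h1.symm.trans h')
  simp only [mul_one, Prod.mk.injEq] at h2
  exact h h2.1

lemma reg_injective {Γ : Type} [Group Γ] [Nonempty X] (q : X ≃ Γ × X) :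
    Function.Injective (reg A q) := by
  intro γ δ h
  obtain ⟨x⟩ := ‹Nonempty X›
  have h1 := reg_apply (A := A) q γ 1 1 x
  rw [h, reg_apply] at h1
  simpa using h1.symm

lemma equiv_prod_of_countable (e : X × ℕ ≃ X) (Γ : Type) [Countable Γ] [Nonempty Γ] :
    Nonempty (X ≃ Γ × X) := by
  obtain ⟨f⟩ : Nonempty (ℕ ≃ Γ × ℕ) := nonempty_equiv_of_countable
  exact ⟨e.symm.trans <| (Equiv.prodComm X ℕ).trans <| (Equiv.prodCongr f (Equiv.refl X)).trans <|
    (Equiv.prodAssoc _ _ _).trans <| Equiv.prodCongr (Equiv.refl Γ) <|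
      (Equiv.prodComm _ _).trans e⟩

lemma tower_stg [Nonempty X] {U : Type} [Group U] (T : Tower (Wr A X) (tau e A) U) :
    StronglyTorsionGenerated U := by
  intro n hn
  have : NeZero n := ⟨by omega⟩
  obtain ⟨q⟩ := equiv_prod_of_countable e (Multiplicative (ZMod n))
  have ho : orderOf (Multiplicative.ofAdd (1 : ZMod n)) = n := by
    rw [orderOf_ofAdd_eq_addOrderOf, ZMod.addOrderOf_one]
  refine ⟨T.ι 0 (reg A q (Multiplicative.ofAdd (1 : ZMod n))), ?_, ?_⟩
  · rw [orderOf_injective _ (T.inj 0), orderOf_injective _ (reg_injective q), ho]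
  · refine tower_normalClosure e T (reg_mv q ?_)
    intro h
    rw [h, orderOf_one] at ho
    omega

/-- translations -/
def tr (A X : Type) [CommGroup A] : A →* Wr A X where
  toFun c := ⟨Equiv.prodCongr (Equiv.mulLeft c) (Equiv.refl X), fun d a x => by
    simp [mul_left_comm]⟩
  map_one' := by
    apply Subtype.ext; ext p <;> simp
  map_mul' a b := by
    apply Subtype.ext; ext p <;> simp [mul_assoc]

lemma tr_apply (c a : A) (x : X) : (tr A X c).1 (a, x) = (c * a, x) := rfl

lemma tr_comm (c : A) (σ : Wr A X) : tr A X c * σ = σ * tr A X c := by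
  apply Subtype.ext
  refine Equiv.ext ?_
  rintro ⟨a, x⟩
  show (tr A X c).1 (σ.1 (a, x)) = σ.1 ((tr A X c).1 (a, x))
  rw [tr_apply c a x, equivar]
  rfl

lemma tr_injective [Nonempty X] : Function.Injective (tr A X) := by
  intro c d h
  obtain ⟨x⟩ := ‹Nonempty X›
  have : (tr A X c).1 (1, x) = (tr A X d).1 (1, x) := by rw [h]
  simpa [tr_apply] using this

lemma eq_tr_of_central [Infinite X] (σ : Wr A X) (h : ∀ π, σ * P A X π = P A X π * σ) :
    ∃ c, σ = tr A X c := by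
  classical
  have h' : ∀ (π : Equiv.Perm X) x, σ.1 (1, π x) = ((σ.1 (1, x)).1, π (σ.1 (1, x)).2) := by
    intro π x
    have : (σ * P A X π).1 (1, x) = (P A X π * σ).1 (1, x) := by rw [h]
    exact this
  have hs : ∀ x, (σ.1 (1, x)).2 = x := by
    intro x
    by_contra hne
    set y := (σ.1 (1, x)).2 with hy
    obtain ⟨z, hz⟩ := Infinite.exists_notMem_finset ({x, y} : Finset X)
    simp only [Finset.mem_insert, Finset.mem_singleton, not_or] at hz
    have h1 := h' (Equiv.swap y z) x
    rw [Equiv.swap_apply_of_ne_of_ne (Ne.symm hne) (Ne.symm hz.1), ← hy] at h1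
    have h2 := congrArg Prod.snd h1
    rw [← hy, Equiv.swap_apply_left] at h2
    exact hz.2 h2.symm
  obtain ⟨x0⟩ : Nonempty X := inferInstance
  refine ⟨(σ.1 (1, x0)).1, ?_⟩
  apply Subtype.ext
  refine Equiv.ext ?_
  rintro ⟨a, x⟩
  have h1 := h' (Equiv.swap x0 x) x0
  rw [Equiv.swap_apply_left] at h1
  have h2 := equivar σ a 1 x
  rw [mul_one] at h2
  rw [h2, tr_apply, hs, h1, mul_comm]

lemma tau_tr (c : A) : tau e A (tr A X c) = tr A X c := by
  apply F_unique
  · intro a x j; rfl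
  · intro a y hy
    exact absurd (e.apply_symm_apply y) (hy (e.symm y))

lemma tower_tr {U : Type} [Group U] (T : Tower (Wr A X) (tau e A) U) (k : ℕ) (c : A) :
    T.ι k (tr A X c) = T.ι 0 (tr A X c) := by
  induction k with
  | zero => rfl
  | succ k ih => rw [← ih, ← T.compat k, tau_tr]

lemma tower_center [Infinite X] {U : Type} [Group U] (T : Tower (Wr A X) (tau e A) U) :
    Nonempty (Subgroup.center U ≃* A) := by
  let f : A →* U := (T.ι 0).comp (tr A X)
  have hf : Function.Injective f := (T.inj 0).comp tr_injective
  have hr : f.range = Subgroup.center U := by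
    ext u
    rw [Subgroup.mem_center_iff]
    constructor
    · rintro ⟨c, rfl⟩ v
      obtain ⟨k, σ, rfl⟩ := T.surj v
      show _ * T.ι 0 _ = T.ι 0 _ * _
      rw [← tower_tr e T k, ← map_mul, ← map_mul, tr_comm]
    · intro h
      obtain ⟨k, σ, rfl⟩ := T.surj u
      obtain ⟨c, rfl⟩ := eq_tr_of_central σ (fun π => T.inj k (by rw [map_mul, map_mul, h]))
      exact ⟨c, (tower_tr e T k c).symm⟩
  exact ⟨((MonoidHom.ofInjective hf).trans (MulEquiv.subgroupCongr hr)).symm⟩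

end Wr

/-- the universal acyclic group with prescribed centre -/
lemma exists_S1 (A : Type) [CommGroup A] : ∃ (U : Type) (_ : Group U),
    StronglyTorsionGenerated U ∧ Nonempty (Subgroup.center U ≃* A) ∧
      ∀ (K : Type) [Group K] (n : ℕ), Nonempty (PH (U × K) n ≃+ PH K n) := by
  obtain ⟨e⟩ : Nonempty (ℕ × ℕ ≃ ℕ) := nonempty_equiv_of_countable
  obtain ⟨U, _, ⟨T⟩⟩ := Tower.exists _ (Wr.tau e A) (Wr.tau_injective e)
  exact ⟨U, _, Wr.tower_stg e T, Wr.tower_center e T,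
    fun K _ n => T.ph_prod (Wr.tau_swindle e) K n⟩

/-- acyclic centreless container -/
structure Cone (G : Type) [Group G] (E : Type) [Group E] where
  i : G →* E
  inj : Function.Injective i
  stg : StronglyTorsionGenerated E
  center : Subgroup.center E = ⊥
  acyc : ∀ n, Subsingleton (PH E n)
  nc : ∀ g, g ≠ 1 → Subgroup.normalClosure {i g} = ⊤

lemma exists_cone (G : Type) [Group G] : ∃ (E : Type) (_ : Group E), Nonempty (Cone G E) := by
  let X := (ℕ → G) × ℕ
  obtain ⟨f⟩ : Nonempty (ℕ × ℕ ≃ ℕ) := nonempty_equiv_of_countable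
  let e : X × ℕ ≃ X := (Equiv.prodAssoc _ _ _).trans (Equiv.prodCongr (Equiv.refl _) f)
  let q0 : (ℕ → G) ≃ G × (ℕ → G) :=
    { toFun := fun u => (u 0, fun n => u (n + 1))
      invFun := fun p n => Nat.casesOn n p.1 p.2
      left_inv := fun u => by funext n; cases n <;> rfl
      right_inv := fun p => rfl }
  let q : X ≃ G × X := (Equiv.prodCongr q0 (Equiv.refl _)).trans (Equiv.prodAssoc _ _ _)
  obtain ⟨U, _, ⟨T⟩⟩ := Tower.exists _ (Wr.tau e PUnit) (Wr.tau_injective e)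
  refine ⟨U, _, ⟨⟨(T.ι 0).comp (Wr.reg PUnit q), (T.inj 0).comp (Wr.reg_injective q),
    Wr.tower_stg e T, ?_, T.ph_zero (Wr.tau_swindle e), fun g hg =>
      Wr.tower_normalClosure e T (Wr.reg_mv q hg)⟩⟩⟩
  obtain ⟨c⟩ := Wr.tower_center e T
  rw [Subgroup.eq_bot_iff_forall]
  intro x hx
  exact congrArg Subtype.val (c.injective (Subsingleton.elim (c ⟨x, hx⟩) (c 1)))


/-! ## Strongly torsion generated groups -/

lemma StronglyTorsionGenerated.commutator_eq_top {G : Type} [Group G]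
    (h : StronglyTorsionGenerated G) : commutator G = ⊤ := by
  have key : ∀ n, 2 ≤ n → ∀ x : G, (Abelianization.of x) ^ n = 1 := by
    intro n hn x
    obtain ⟨g, hg, hN⟩ := h n hn
    let f : G →* Abelianization G := (powMonoidHom n).comp Abelianization.of
    have h1 : Subgroup.normalClosure {g} ≤ f.ker := by
      refine Subgroup.normalClosure_le_normal (Set.singleton_subset_iff.2 ?_)
      show (Abelianization.of g) ^ n = 1
      rw [← map_pow, ← hg, pow_orderOf_eq_one, map_one]
    rw [hN] at h1
    exact h1 (Subgroup.mem_top x)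
  rw [eq_top_iff]
  intro x _
  rw [← Abelianization.ker_of, MonoidHom.mem_ker]
  have h2 := key 2 le_rfl x
  have h3 := key 3 (by norm_num) x
  rw [pow_succ, h2, one_mul] at h3
  exact h3

lemma StronglyTorsionGenerated.eq_top_of_finiteIndex {G : Type} [Group G]
    (h : StronglyTorsionGenerated G) (H : Subgroup G) [H.FiniteIndex] : H = ⊤ := by
  have h1 : H.normalCore.index ≠ 0 := Subgroup.FiniteIndex.index_ne_zero
  obtain ⟨g, hg, hN⟩ := h (H.normalCore.index + 1) (by omega)
  have h2 : g ^ H.normalCore.index ∈ H.normalCore := Subgroup.pow_index_mem _ _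
  have h3 : g ∈ H.normalCore := by
    have h4 : g ^ (H.normalCore.index + 1) = 1 := by rw [← hg]; exact pow_orderOf_eq_one g
    rw [pow_succ] at h4
    have := eq_inv_of_mul_eq_one_right h4
    rw [this]
    exact Subgroup.inv_mem _ h2
  rw [eq_top_iff, ← hN]
  refine le_trans (Subgroup.normalClosure_le_normal (Set.singleton_subset_iff.2 ?_)) (Subgroup.normalCore_le H)
  exact h3

lemma StronglyTorsionGenerated.prod {G H : Type} [Group G] [Group H]
    (hG : StronglyTorsionGenerated G) (hH : StronglyTorsionGenerated H) :
    StronglyTorsionGenerated (G × H) := by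
  intro n hn
  obtain ⟨g, hg, hgN⟩ := hG n hn
  obtain ⟨h, hh, hhN⟩ := hH n hn
  refine ⟨(g, h), ?_, ?_⟩
  · rw [Prod.orderOf_mk, hg, hh, Nat.lcm_self]
  · set N := Subgroup.normalClosure {(g, h)} with hNdef
    have hmem : (g, h) ∈ N := Subgroup.subset_normalClosure rfl
    -- kernel in the first factor
    have h1 : ∀ x y : G, (x * y * x⁻¹ * y⁻¹, (1 : H)) ∈ N := by
      intro x y
      let Z : Subgroup (G ⧸ (N.comap (MonoidHom.inl G H))) := Subgroup.center _
      have : Subgroup.normalClosure {g} ≤ Z.comap (QuotientGroup.mk' _) := by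
        refine Subgroup.normalClosure_le_normal (Set.singleton_subset_iff.2 ?_)
        simp only [SetLike.mem_coe, Subgroup.mem_comap]
        rw [Subgroup.mem_center_iff]
        intro q
        obtain ⟨x, rfl⟩ := QuotientGroup.mk'_surjective _ q
        rw [← map_mul, ← map_mul, eq_comm, QuotientGroup.mk'_eq_mk']
        refine ⟨(g * x)⁻¹ * (x * g), ?_, by group⟩
        rw [Subgroup.mem_comap]
        have := N.mul_mem (Subgroup.normalClosure_normal.conj_mem _ (N.inv_mem hmem) (x⁻¹, 1)) hmem
        convert this using 1
        simp [mul_assoc]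
      rw [hgN] at this
      have hx := this (Subgroup.mem_top x)
      rw [Subgroup.mem_comap, Subgroup.mem_center_iff] at hx
      have h2 := hx (QuotientGroup.mk' _ y)
      have h3 : QuotientGroup.mk' (N.comap (MonoidHom.inl G H)) (x * y * x⁻¹ * y⁻¹) = 1 := by
        rw [map_mul, map_mul, map_mul, ← h2, map_inv, map_inv]; group
      exact (QuotientGroup.eq_one_iff (N := N.comap (MonoidHom.inl G H)) _).1 h3
    have h2 : ∀ x : G, (x, (1 : H)) ∈ N := by
      have : commutator G ≤ N.comap (MonoidHom.inl G H) := by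
        rw [commutator_def, Subgroup.commutator_le]
        intro x _ y _
        exact h1 x y
      rw [hG.commutator_eq_top] at this
      exact fun x => this (Subgroup.mem_top x)
    have h3 : ∀ y : H, ((1 : G), y) ∈ N := by
      have : Subgroup.normalClosure {h} ≤ N.comap (MonoidHom.inr G H) := by
        refine Subgroup.normalClosure_le_normal (Set.singleton_subset_iff.2 ?_)
        have := N.mul_mem (h2 g⁻¹) hmem
        simpa using this
      rw [hhN] at this
      exact fun x => this (Subgroup.mem_top x)
    rw [eq_top_iff]
    rintro ⟨x, y⟩ _
    have := N.mul_mem (h2 x) (h3 y)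
    simpa using this

/-! ## Amalgamated doubles -/

/-- `S` is the double of `E` along `G`. -/
structure Amal {G E : Type} [Group G] [Group E] (i : G →* E) (S : Type) [Group S] where
  i1 : E →* S
  i2 : E →* S
  comm : ∀ g, i1 (i g) = i2 (i g)
  gen : i1.range ⊔ i2.range = ⊤
  lift : ∀ (K : Type) [Group K] (f1 f2 : E →* K), (∀ g, f1 (i g) = f2 (i g)) →
    ∃ f : S →* K, (∀ x, f (i1 x) = f1 x) ∧ ∀ x, f (i2 x) = f2 x

lemma Amal.exists {G E : Type} [Group G] [Group E] (i : G →* E) :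
    ∃ (S : Type) (_ : Group S), Nonempty (Amal i S) := by
  let φ : Bool → G →* E := fun _ => i
  refine ⟨Monoid.PushoutI φ, inferInstance, ⟨⟨Monoid.PushoutI.of (φ := φ) true,
    Monoid.PushoutI.of (φ := φ) false, ?_, ?_, ?_⟩⟩⟩
  · intro g
    exact (Monoid.PushoutI.of_apply_eq_base φ true g).trans
      (Monoid.PushoutI.of_apply_eq_base φ false g).symm
  · rw [eq_top_iff]
    intro x _
    induction x using Monoid.PushoutI.induction_on with
    | of j g =>
      cases j
      · exact Subgroup.mem_sup_right ⟨g, rfl⟩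
      · exact Subgroup.mem_sup_left ⟨g, rfl⟩
    | base h =>
      rw [← Monoid.PushoutI.of_apply_eq_base φ true h]
      exact Subgroup.mem_sup_left ⟨_, rfl⟩
    | mul x y hx hy => exact Subgroup.mul_mem _ (hx trivial) (hy trivial)
  · intro K _ f1 f2 h
    refine ⟨Monoid.PushoutI.lift (fun b => Bool.casesOn b f2 f1) (f1.comp i) ?_, ?_, ?_⟩
    · rintro (_ | _)
      · ext g; exact (h g).symm
      · rfl
    · intro x
      exact Monoid.PushoutI.lift_of (φ := φ) _ _ _ (i := true) x
    · intro x
      exact Monoid.PushoutI.lift_of (φ := φ) _ _ _ (i := false) x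

namespace Amal
variable {G E S : Type} [Group G] [Group E] [Group S] {i : G →* E} (D : Amal i S)

lemma exists_fold : ∃ f : S →* E, (∀ x, f (D.i1 x) = x) ∧ ∀ x, f (D.i2 x) = x :=
  D.lift E (MonoidHom.id E) (MonoidHom.id E) (fun _ => rfl)

lemma i1_inj : Function.Injective D.i1 := by
  obtain ⟨f, h, -⟩ := D.exists_fold
  exact Function.LeftInverse.injective h

lemma i2_inj : Function.Injective D.i2 := by
  obtain ⟨f, -, h⟩ := D.exists_fold
  exact Function.LeftInverse.injective h

/-- induction principle -/
lemma ind {p : S → Prop} (h1 : ∀ x, p (D.i1 x)) (h2 : ∀ x, p (D.i2 x))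
    (hm : ∀ x y, p x → p y → p (x * y)) (hi : ∀ x, p x → p x⁻¹) (s : S) : p s := by
  let H : Subgroup S :=
    { carrier := {s | p s}
      one_mem' := by have := h1 1; rwa [map_one] at this
      mul_mem' := fun {x y} hx hy => hm x y hx hy
      inv_mem' := fun {x} hx => hi x hx }
  have : D.i1.range ⊔ D.i2.range ≤ H := by
    refine sup_le ?_ ?_
    · rintro _ ⟨x, rfl⟩; exact h1 x
    · rintro _ ⟨x, rfl⟩; exact h2 x
  rw [D.gen] at this
  exact this (Subgroup.mem_top s)

lemma commutator_eq_top (D : Amal i S) (hE : commutator E = ⊤) : commutator S = ⊤ := by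
  rw [eq_top_iff, ← D.gen]
  have : ∀ f : E →* S, f.range ≤ commutator S := by
    intro f
    rw [MonoidHom.range_eq_map, ← hE, commutator_def, commutator_def, Subgroup.map_commutator]
    exact Subgroup.commutator_mono le_top le_top
  exact sup_le (this _) (this _)

lemma stg (D : Amal i S) (hE : StronglyTorsionGenerated E)
    (hnc : ∃ g, Subgroup.normalClosure {i g} = ⊤) : StronglyTorsionGenerated S := by
  intro n hn
  obtain ⟨x, hx, hN⟩ := hE n hn
  obtain ⟨g, hg⟩ := hnc
  refine ⟨D.i1 x, by rw [orderOf_injective _ D.i1_inj, hx], ?_⟩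
  set N := Subgroup.normalClosure {D.i1 x}
  have h1 : ∀ y, D.i1 y ∈ N := by
    have : Subgroup.normalClosure {x} ≤ N.comap D.i1 := by
      refine Subgroup.normalClosure_le_normal (Set.singleton_subset_iff.2 ?_)
      exact Subgroup.subset_normalClosure rfl
    rw [hN] at this
    exact fun y => this (Subgroup.mem_top y)
  have h2 : ∀ y, D.i2 y ∈ N := by
    have : Subgroup.normalClosure {i g} ≤ N.comap D.i2 := by
      refine Subgroup.normalClosure_le_normal (Set.singleton_subset_iff.2 ?_)
      show D.i2 (i g) ∈ N
      rw [← D.comm]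
      exact h1 _
    rw [hg] at this
    exact fun y => this (Subgroup.mem_top y)
  rw [eq_top_iff]
  intro s _
  exact D.ind h1 h2 (fun _ _ => N.mul_mem) (fun _ => N.inv_mem) s

end Amal


/-! ## Permutation modules and the Mayer-Vietoris sequence -/

/-- Permutation representation. -/
noncomputable def pr (S Y : Type) [Group S] [MulAction S Y] : Representation ℤ S (Y →₀ ℤ) where
  toFun g := Finsupp.lmapDomain ℤ ℤ (g • ·)
  map_one' := by
    refine Finsupp.lhom_ext fun y c => ?_
    simp [Finsupp.mapDomain_single]
  map_mul' g h := by
    refine Finsupp.lhom_ext fun y c => ?_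
    simp [Finsupp.mapDomain_single, mul_smul]

lemma pr_single {S Y : Type} [Group S] [MulAction S Y] (g : S) (y : Y) (c : ℤ) :
    pr S Y g (Finsupp.single y c) = Finsupp.single (g • y) c := by
  simp [pr, Finsupp.mapDomain_single]

lemma pr_mul {S Y : Type} [Group S] [MulAction S Y] (g h : S) (v : Y →₀ ℤ) :
    pr S Y (g * h) v = pr S Y g (pr S Y h v) := by
  rw [map_mul]; rfl

lemma pr_one {S Y : Type} [Group S] [MulAction S Y] (v : Y →₀ ℤ) :
    pr S Y 1 v = v := by
  rw [map_one]; rfl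

/-- the action of `g` as a permutation of the module -/
noncomputable def prPerm (S Y : Type) [Group S] [MulAction S Y] :
    S →* Equiv.Perm (Y →₀ ℤ) where
  toFun g := ⟨pr S Y g, pr S Y g⁻¹, fun v => by rw [← pr_mul]; simp [pr_one],
    fun v => by rw [← pr_mul]; simp [pr_one]⟩
  map_one' := by ext1 v; exact pr_one v
  map_mul' g h := by ext1 v; exact pr_mul g h v

namespace Amal
variable {G E S : Type} [Group G] [Group E] [Group S] {i : G →* E} (D : Amal i S)

/-- the amalgamated subgroup -/
def H0 : Subgroup S := (D.i1.comp i).range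

lemma mem_H0 {s : S} : s ∈ D.H0 ↔ ∃ g, D.i1 (i g) = s := Iff.rfl

lemma H0_le1 : D.H0 ≤ D.i1.range := by
  rintro _ ⟨g, rfl⟩; exact ⟨i g, rfl⟩

lemma H0_le2 : D.H0 ≤ D.i2.range := by
  rintro _ ⟨g, rfl⟩; exact ⟨i g, (D.comm g).symm⟩

/-- base coset -/
noncomputable def b0 : (S ⧸ D.H0) →₀ ℤ := Finsupp.single (QuotientGroup.mk 1) 1

lemma pr_b0 (s : S) : pr S (S ⧸ D.H0) s D.b0 = Finsupp.single (QuotientGroup.mk s) 1 := by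
  rw [b0, pr_single]
  congr 1
  show QuotientGroup.mk (s * 1) = _
  rw [mul_one]

lemma exists_der : ∃ d : S → ((S ⧸ D.H0) →₀ ℤ),
    (∀ s t, d (s * t) = d s + pr S _ s (d t)) ∧ (∀ x, d (D.i1 x) = 0) ∧
    ∀ x, d (D.i2 x) = pr S _ (D.i2 x) D.b0 - D.b0 := by
  let L := prPerm S (S ⧸ D.H0)
  let T : Equiv.Perm ((S ⧸ D.H0) →₀ ℤ) := Equiv.addRight D.b0
  have hL : ∀ s v, L s v = pr S _ s v := fun s v => rfl
  obtain ⟨f, h1, h2⟩ := D.lift (Equiv.Perm ((S ⧸ D.H0) →₀ ℤ)) (L.comp D.i1)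
    (((MulAut.conj T⁻¹).toMonoidHom.comp L).comp D.i2) (by
      intro g
      ext1 v
      have e2 : (((MulAut.conj T⁻¹).toMonoidHom.comp L).comp D.i2) (i g) v =
        pr S _ (D.i2 (i g)) (v + D.b0) - D.b0 := by
        simp [MulAut.conj_apply, T, hL, sub_eq_add_neg, Equiv.Perm.inv_def]
      rw [e2, map_add, ← D.comm, D.pr_b0, b0]
      have : (QuotientGroup.mk (D.i1 (i g)) : S ⧸ D.H0) = QuotientGroup.mk 1 := by
        rw [eq_comm, QuotientGroup.eq]
        exact ⟨g, by simp⟩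
      rw [this, add_sub_cancel_right]
      rfl)
  have e2 : ∀ x v, f (D.i2 x) v = pr S _ (D.i2 x) (v + D.b0) - D.b0 := by
    intro x v
    rw [h2]
    simp [MulAut.conj_apply, T, hL, sub_eq_add_neg, Equiv.Perm.inv_def]
  have e1 : ∀ x v, f (D.i1 x) v = pr S _ (D.i1 x) v := by
    intro x v
    rw [h1]; rfl
  have aff : ∀ s, ∀ v, f s v = f s 0 + pr S _ s v := by
    intro s
    refine D.ind (p := fun s => ∀ v, f s v = f s 0 + pr S _ s v) ?_ ?_ ?_ ?_ s
    · intro x v; rw [e1, e1, map_zero, zero_add]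
    · intro x v; rw [e2, e2, zero_add, map_add]; abel
    · intro x y hx hy v
      rw [map_mul, Equiv.Perm.mul_apply, Equiv.Perm.mul_apply, hx (f y v), hx (f y 0), hy v,
        pr_mul, map_add, add_assoc]
    · intro x hx v
      rw [map_inv]
      have hai : ∀ v, f x ((f x)⁻¹ v) = v := fun v => (f x).apply_symm_apply v
      apply (f x).injective
      rw [hai, hx (_ + _), map_add, ← pr_mul, mul_inv_cancel, pr_one,
        ← add_assoc, ← hx, hai, zero_add]
  refine ⟨fun s => f s 0, ?_, ?_, ?_⟩
  · intro s t
    show f (s * t) 0 = _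
    rw [map_mul, Equiv.Perm.mul_apply, aff s]
  · intro x; show f _ 0 = 0; rw [e1, map_zero]
  · intro x; show f _ 0 = _; rw [e2, zero_add]

/-- the derivation -/
noncomputable def der : S → ((S ⧸ D.H0) →₀ ℤ) := D.exists_der.choose

lemma der_mul (s t : S) : D.der (s * t) = D.der s + pr S _ s (D.der t) :=
  D.exists_der.choose_spec.1 s t

lemma der_i1 (x : E) : D.der (D.i1 x) = 0 := D.exists_der.choose_spec.2.1 x

lemma der_i2 (x : E) : D.der (D.i2 x) = pr S _ (D.i2 x) D.b0 - D.b0 :=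
  D.exists_der.choose_spec.2.2 x

/-- vertices of the tree -/
abbrev Vt := (S ⧸ D.i1.range) ⊕ (S ⧸ D.i2.range)

/-- first endpoint -/
def e1 : S ⧸ D.H0 → D.Vt := fun q => Sum.inl (Subgroup.quotientMapOfLE D.H0_le1 q)

/-- second endpoint -/
def e2 : S ⧸ D.H0 → D.Vt := fun q => Sum.inr (Subgroup.quotientMapOfLE D.H0_le2 q)

lemma e1_mk (s : S) : D.e1 (QuotientGroup.mk s) = Sum.inl (QuotientGroup.mk s) := rfl
lemma e2_mk (s : S) : D.e2 (QuotientGroup.mk s) = Sum.inr (QuotientGroup.mk s) := rfl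

lemma e1_smul (s : S) (q) : D.e1 (s • q) = s • D.e1 q := by
  induction q using QuotientGroup.induction_on; rfl
lemma e2_smul (s : S) (q) : D.e2 (s • q) = s • D.e2 q := by
  induction q using QuotientGroup.induction_on; rfl

/-- boundary of the tree -/
noncomputable def del : ((S ⧸ D.H0) →₀ ℤ) →ₗ[ℤ] (D.Vt →₀ ℤ) :=
  Finsupp.lmapDomain ℤ ℤ D.e1 - Finsupp.lmapDomain ℤ ℤ D.e2

lemma del_single (q) (c : ℤ) : D.del (Finsupp.single q c) =
    Finsupp.single (D.e1 q) c - Finsupp.single (D.e2 q) c := by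
  simp [del, Finsupp.mapDomain_single]

lemma del_pr (s : S) (v) : D.del (pr S _ s v) = pr S _ s (D.del v) := by
  induction v using Finsupp.induction_linear with
  | zero => simp
  | add f g hf hg => simp only [map_add, hf, hg]
  | single q c => rw [pr_single, del_single, del_single, map_sub, pr_single, pr_single, e1_smul,
      e2_smul]

/-- single vertices -/
noncomputable def v1 (s : S) : D.Vt →₀ ℤ := Finsupp.single (Sum.inl (QuotientGroup.mk s)) 1
/-- single vertices -/
noncomputable def v2 (s : S) : D.Vt →₀ ℤ := Finsupp.single (Sum.inr (QuotientGroup.mk s)) 1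

lemma pr_v1 (s t : S) : pr S _ s (D.v1 t) = D.v1 (s * t) := by
  rw [v1, pr_single]; rfl
lemma pr_v2 (s t : S) : pr S _ s (D.v2 t) = D.v2 (s * t) := by
  rw [v2, pr_single]; rfl

lemma v1_i1 (s : S) (x : E) : D.v1 (s * D.i1 x) = D.v1 s := by
  rw [v1, v1]
  congr 2
  rw [eq_comm, QuotientGroup.eq]
  exact ⟨x, by simp⟩

lemma v2_i2 (s : S) (x : E) : D.v2 (s * D.i2 x) = D.v2 s := by
  rw [v2, v2]
  congr 2
  rw [eq_comm, QuotientGroup.eq]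
  exact ⟨x, by simp⟩

lemma del_b0 (s : S) : D.del (pr S _ s D.b0) = D.v1 s - D.v2 s := by
  rw [pr_b0, del_single]; rfl

lemma del_der (s : S) : D.del (D.der s) = D.v1 s - D.v1 1 := by
  refine D.ind (p := fun s => D.del (D.der s) = D.v1 s - D.v1 1) ?_ ?_ ?_ ?_ s
  · intro x
    rw [der_i1, map_zero]
    have := D.v1_i1 1 x
    rw [one_mul] at this
    rw [this, sub_self]
  · intro x
    have := D.v2_i2 1 x
    rw [one_mul] at this
    have h1 := D.del_b0 1
    rw [pr_one] at h1
    rw [der_i2, map_sub, del_b0, h1, this]; abel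
  · intro x y hx hy
    rw [der_mul, map_add, del_pr, hx, hy, map_sub, pr_v1, pr_v1, mul_one]; abel
  · intro x hx
    have h1 : D.der 1 = 0 := by have := D.der_i1 1; rwa [map_one] at this
    have h := D.der_mul x⁻¹ x
    rw [inv_mul_cancel, h1] at h
    rw [eq_neg_of_add_eq_zero_left h.symm, map_neg, del_pr, hx, map_sub, pr_v1, pr_v1,
      inv_mul_cancel, mul_one]; abel

/-- contraction on vertices -/
noncomputable def hv : D.Vt → ((S ⧸ D.H0) →₀ ℤ) :=
  Sum.elim (fun q => Quotient.liftOn' q D.der (by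
      intro a b h
      rw [QuotientGroup.leftRel_apply] at h
      obtain ⟨x, hx⟩ := h
      obtain rfl : b = a * D.i1 x := by rw [hx]; group
      rw [der_mul, der_i1, map_zero, add_zero]))
    (fun q => Quotient.liftOn' q (fun s => D.der s - pr S _ s D.b0) (by
      intro a b h
      rw [QuotientGroup.leftRel_apply] at h
      obtain ⟨x, hx⟩ := h
      obtain rfl : b = a * D.i2 x := by rw [hx]; group
      show _ = D.der (a * D.i2 x) - _
      rw [der_mul, der_i2, map_sub, pr_mul]; abel))

/-- contraction -/
noncomputable def hc : (D.Vt →₀ ℤ) →ₗ[ℤ] ((S ⧸ D.H0) →₀ ℤ) := Finsupp.linearCombination ℤ D.hv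

lemma hc_v1 (s : S) : D.hc (D.v1 s) = D.der s := by
  simp only [hc, v1, Finsupp.linearCombination_single, one_smul]; rfl

lemma hc_v2 (s : S) : D.hc (D.v2 s) = D.der s - pr S _ s D.b0 := by
  simp only [hc, v2, Finsupp.linearCombination_single, one_smul]; rfl

lemma hc_del (v) : D.hc (D.del v) = v := by
  suffices D.hc ∘ₗ D.del = LinearMap.id from LinearMap.congr_fun this v
  refine Finsupp.lhom_ext' fun q => LinearMap.ext_ring ?_
  induction q using QuotientGroup.induction_on with
  | H s =>
    show D.hc (D.del (Finsupp.single _ 1)) = Finsupp.single _ 1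
    rw [← pr_b0, del_b0, map_sub, hc_v1, hc_v2]; abel

/-- augmentation -/
noncomputable def aug : (D.Vt →₀ ℤ) →ₗ[ℤ] ℤ := Finsupp.linearCombination ℤ (fun _ => 1)

lemma aug_single (q) (c : ℤ) : D.aug (Finsupp.single q c) = c := by
  simp [aug, Finsupp.linearCombination_single]

lemma aug_pr (s : S) (v) : D.aug (pr S _ s v) = D.aug v := by
  induction v using Finsupp.induction_linear with
  | zero => simp
  | add f g hf hg => simp only [map_add, hf, hg]
  | single q c => rw [pr_single, aug_single, aug_single]

lemma aug_del (v) : D.aug (D.del v) = 0 := by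
  induction v using Finsupp.induction_linear with
  | zero => simp
  | add f g hf hg => simp only [map_add, hf, hg, add_zero]
  | single q c => rw [del_single, map_sub, aug_single, aug_single, sub_self]

lemma del_hc (v) : D.del (D.hc v) = v - D.aug v • D.v1 1 := by
  suffices D.del ∘ₗ D.hc = LinearMap.id - D.aug.smulRight (D.v1 1) from LinearMap.congr_fun this v
  refine Finsupp.lhom_ext' fun q => LinearMap.ext_ring ?_
  show D.del (D.hc (Finsupp.single _ 1)) =
    Finsupp.single _ 1 - D.aug (Finsupp.single _ 1) • D.v1 1
  rw [aug_single, one_smul]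
  rcases q with q | q <;> induction q using QuotientGroup.induction_on with
  | H s => _
  · show D.del (D.hc (D.v1 s)) = D.v1 s - _
    rw [hc_v1, del_der]
  · show D.del (D.hc (D.v2 s)) = D.v2 s - _
    rw [hc_v2, map_sub, del_der, del_b0]; abel

end Amal


/-! ## Homology of amalgams -/

section shapiro
variable {S : Type} [Group S] (H : Subgroup S)

/-- the trivial representation -/
abbrev trv (G : Type) [Group G] : Representation ℤ G ℤ := (Rep.trivial ℤ G ℤ).ρ

/-- forward map -/
noncomputable def indFwd : Representation.IndV H.subtype (trv H) →ₗ[ℤ] ((S ⧸ H) →₀ ℤ) :=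
  Representation.Coinvariants.lift _
    (((Finsupp.linearCombination ℤ (fun s : S => Finsupp.single (QuotientGroup.mk s⁻¹ : S ⧸ H) (1 : ℤ))).comp
      (MonoidAlgebra.coeffLinearEquiv ℤ).toLinearMap).comp
      (TensorProduct.rid ℤ (MonoidAlgebra ℤ S)).toLinearMap) (by
    intro x
    refine TensorProduct.ext <| MonoidAlgebra.lhom_ext' fun h => LinearMap.ext_ring <|
      LinearMap.ext_ring ?_
    simp [Finsupp.linearCombination_single])

lemma indFwd_mk (s : S) (c : ℤ) : indFwd H (Representation.IndV.mk H.subtype (trv H) s c) =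
    Finsupp.single (QuotientGroup.mk s⁻¹) c := by
  refine (Representation.Coinvariants.lift_mk _ _ _ _).trans ?_
  simp [Finsupp.linearCombination_single]

lemma indMk_mul (s : S) (x : H) (c : ℤ) :
    Representation.IndV.mk H.subtype (trv H) (x.1 * s) c =
      Representation.IndV.mk H.subtype (trv H) s c := by
  have := Representation.Coinvariants.mk_self_apply
    (Representation.tprod ((Representation.leftRegular ℤ S).comp H.subtype) (trv H)) x
      (TensorProduct.tmul ℤ (MonoidAlgebra.single s (1 : ℤ)) c)
  refine Eq.trans ?_ this
  show Representation.Coinvariants.mk _ (TensorProduct.tmul ℤ (MonoidAlgebra.single (x.1 * s) (1 : ℤ)) c)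
    = _
  congr 1
  simp

/-- backward map -/
noncomputable def indBwd : ((S ⧸ H) →₀ ℤ) →ₗ[ℤ] Representation.IndV H.subtype (trv H) :=
  Finsupp.linearCombination ℤ (fun q => Quotient.liftOn' q
    (fun s => Representation.IndV.mk H.subtype (trv H) s⁻¹ (1 : ℤ)) (by
      intro a b h
      rw [QuotientGroup.leftRel_apply] at h
      have := indMk_mul H b⁻¹ ⟨_, h⟩ 1
      refine Eq.trans ?_ this
      show _ = Representation.IndV.mk H.subtype (trv H) (a⁻¹ * b * b⁻¹) 1
      rw [mul_inv_cancel_right]))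

lemma indBwd_single (s : S) (c : ℤ) : indBwd H (Finsupp.single (QuotientGroup.mk s) c) =
    Representation.IndV.mk H.subtype (trv H) s⁻¹ c := by
  refine (Finsupp.linearCombination_single ℤ c _).trans ?_
  show c • Representation.IndV.mk H.subtype (trv H) s⁻¹ (1 : ℤ) = _
  rw [← map_smul]
  congr 1
  simp

lemma indFwd_Bwd (v) : indFwd H (indBwd H v) = v := by
  induction v using Finsupp.induction_linear with
  | zero => rw [map_zero, map_zero]
  | add f g hf hg => rw [map_add, map_add, hf, hg]
  | single q c =>
    induction q using QuotientGroup.induction_on with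
    | H s => rw [indBwd_single, indFwd_mk, inv_inv]

lemma indBwd_Fwd (v) : indBwd H (indFwd H v) = v := by
  suffices indBwd H ∘ₗ indFwd H = LinearMap.id from LinearMap.congr_fun this v
  refine Representation.IndV.hom_ext _ _ fun s => LinearMap.ext fun c => ?_
  show indBwd H (indFwd H _) = Representation.IndV.mk H.subtype (trv H) s c
  rw [indFwd_mk, indBwd_single, inv_inv]

/-- induced trivial representations are permutation representations -/
noncomputable def indEquiv :
    ((trv H).ind H.subtype).Equiv (pr S (S ⧸ H)) :=
  Representation.Equiv.mk (LinearEquiv.ofLinearMap (indFwd H) (indBwd H)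
      (LinearMap.ext (indFwd_Bwd H)) (LinearMap.ext (indBwd_Fwd H))) (by
    intro g
    refine Representation.IndV.hom_ext _ _ fun s => LinearMap.ext fun c => ?_
    show indFwd H ((trv H).ind H.subtype g (Representation.IndV.mk H.subtype (trv H) s c)) =
      pr S (S ⧸ H) g (indFwd H (Representation.IndV.mk H.subtype (trv H) s c))
    rw [Representation.ind_mk, indFwd_mk, indFwd_mk, pr_single, mul_inv_rev, inv_inv]
    rfl)

lemma shapiro (n : ℕ) : Nonempty (groupHomology (Rep.of (pr S (S ⧸ H))) (n + 1) ≃+ PH H n) := by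
  classical
  obtain ⟨e⟩ := groupHomology_equiv H n
  let i1 : Rep.ind H.subtype (Rep.trivial ℤ H ℤ) ≅ Rep.of (pr S (S ⧸ H)) := Rep.mkIso (indEquiv H)
  let i2 := (groupHomology.functor ℤ S (n + 1)).mapIso i1
  let i3 := groupHomology.indIso H (Rep.trivial ℤ H ℤ) (n + 1)
  let i4 : groupHomology (Rep.of (pr S (S ⧸ H))) (n + 1) ≅
    groupHomology (Rep.trivial ℤ H ℤ) (n + 1) := i2.symm ≪≫ i3
  exact ⟨i4.toLinearEquiv.toAddEquiv.trans e⟩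

end shapiro

lemma rep_shortExact {k G : Type} [CommRing k] [Group G] (X : ShortComplex (Rep.{0} k G))
    (hf : Function.Injective X.f.hom) (hg : Function.Surjective X.g.hom)
    (hx : ∀ v, X.g.hom v = 0 → ∃ u, X.f.hom u = v) : X.ShortExact where
  exact := (forget₂ (Rep.{0} k G) (ModuleCat.{0} k)).reflects_exact_of_faithful _ <|
    (ShortComplex.moduleCat_exact_iff _).2 hx
  mono_f := (Rep.mono_iff_injective _).2 hf
  epi_g := (Rep.epi_iff_surjective _).2 hg

section sums
variable {S Y Z : Type} [Group S] [MulAction S Y] [MulAction S Z]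

/-- inclusion -/
noncomputable def sumInl : (Y →₀ ℤ) →ₗ[ℤ] (Y ⊕ Z →₀ ℤ) := Finsupp.lmapDomain ℤ ℤ Sum.inl

/-- inclusion -/
noncomputable def sumInr : (Z →₀ ℤ) →ₗ[ℤ] (Y ⊕ Z →₀ ℤ) := Finsupp.lmapDomain ℤ ℤ Sum.inr

/-- projection -/
noncomputable def sumFst : (Y ⊕ Z →₀ ℤ) →ₗ[ℤ] (Y →₀ ℤ) :=
  Finsupp.linearCombination ℤ (Sum.elim (fun z => Finsupp.single z 1) (fun _ => 0))

/-- projection -/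
noncomputable def sumSnd : (Y ⊕ Z →₀ ℤ) →ₗ[ℤ] (Z →₀ ℤ) :=
  Finsupp.linearCombination ℤ (Sum.elim (fun _ => 0) (fun z => Finsupp.single z 1))

lemma sumInl_single (y : Y) (c : ℤ) :
    sumInl (Z := Z) (Finsupp.single y c) = Finsupp.single (Sum.inl y) c := by
  simp [sumInl, Finsupp.mapDomain_single]

lemma sumInr_single (z : Z) (c : ℤ) :
    sumInr (Y := Y) (Finsupp.single z c) = Finsupp.single (Sum.inr z) c := by
  simp [sumInr, Finsupp.mapDomain_single]

lemma sumSnd_inl (y : Y) (c : ℤ) :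
    sumSnd (Z := Z) (Finsupp.single (Sum.inl y) c) = 0 := by
  simp [sumSnd, Finsupp.linearCombination_single]

lemma sumSnd_inr (z : Z) (c : ℤ) :
    sumSnd (Y := Y) (Finsupp.single (Sum.inr z) c) = Finsupp.single z c := by
  simp [sumSnd, Finsupp.linearCombination_single]

lemma sumFst_inl (y : Y) (c : ℤ) :
    sumFst (Z := Z) (Finsupp.single (Sum.inl y) c) = Finsupp.single y c := by
  simp [sumFst, Finsupp.linearCombination_single]

lemma sumFst_inr (z : Z) (c : ℤ) :
    sumFst (Y := Y) (Finsupp.single (Sum.inr z) c) = 0 := by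
  simp [sumFst, Finsupp.linearCombination_single]

lemma sum_id (v : Y ⊕ Z →₀ ℤ) : sumInl (sumFst v) + sumInr (sumSnd v) = v := by
  induction v using Finsupp.induction_linear with
  | zero => simp
  | add f g hf hg =>
    simp only [map_add]
    nth_rewrite 3 [← hf]
    nth_rewrite 3 [← hg]
    abel
  | single q c =>
    rcases q with y | z
    · rw [sumFst_inl, sumSnd_inl, sumInl_single, map_zero, add_zero]
    · rw [sumFst_inr, sumSnd_inr, sumInr_single, map_zero, zero_add]

lemma sumFst_sumInl (v : Y →₀ ℤ) : sumFst (sumInl (Z := Z) v) = v := by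
  induction v using Finsupp.induction_linear with
  | zero => simp
  | add f g hf hg => simp only [map_add, hf, hg]
  | single q c => rw [sumInl_single, sumFst_inl]

lemma sumSnd_sumInl (v : Y →₀ ℤ) : sumSnd (sumInl (Z := Z) v) = 0 := by
  induction v using Finsupp.induction_linear with
  | zero => simp
  | add f g hf hg => simp only [map_add, hf, hg, add_zero]
  | single q c => rw [sumInl_single, sumSnd_inl]

lemma sumSnd_sumInr (v : Z →₀ ℤ) : sumSnd (sumInr (Y := Y) v) = v := by
  induction v using Finsupp.induction_linear with
  | zero => simp
  | add f g hf hg => simp only [map_add, hf, hg]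
  | single q c => rw [sumInr_single, sumSnd_inr]

lemma exInl (v : Y ⊕ Z →₀ ℤ) (h2 : sumSnd v = 0) : ∃ u, sumInl (Z := Z) u = v := by
  refine ⟨sumFst v, ?_⟩
  have h1 := sum_id v
  rwa [h2, map_zero, add_zero] at h1

lemma isZero_sum (n : ℕ) (hY : Limits.IsZero (groupHomology (Rep.of (pr S Y)) n))
    (hZ : Limits.IsZero (groupHomology (Rep.of (pr S Z)) n)) :
    Limits.IsZero (groupHomology (Rep.of (pr S (Y ⊕ Z))) n) := by
  let f : Rep.of (pr S Y) ⟶ Rep.of (pr S (Y ⊕ Z)) := Rep.ofHom ⟨sumInl, by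
    intro g
    refine Finsupp.lhom_ext fun y c => ?_
    show sumInl (pr S Y g _) = pr S _ g (sumInl _)
    rw [pr_single, sumInl_single, sumInl_single, pr_single]; rfl⟩
  let g : Rep.of (pr S (Y ⊕ Z)) ⟶ Rep.of (pr S Z) := Rep.ofHom ⟨sumSnd, by
    intro g
    refine Finsupp.lhom_ext fun y c => ?_
    show sumSnd (pr S _ g _) = pr S _ g (sumSnd _)
    rcases y with y | y
    · rw [pr_single, sumSnd_inl, Sum.smul_inl, sumSnd_inl, map_zero]
    · rw [pr_single, sumSnd_inr, Sum.smul_inr, sumSnd_inr, pr_single]⟩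
  let X : ShortComplex (Rep.{0} ℤ S) := ShortComplex.mk f g (by
    exact Rep.hom_ext (Representation.IntertwiningMap.ext (LinearMap.ext fun v => sumSnd_sumInl v)))
  have hX : X.ShortExact :=
    rep_shortExact X (Function.LeftInverse.injective sumFst_sumInl)
      (Function.RightInverse.surjective sumSnd_sumInr) (by
          intro v hv
          exact exInl v hv)
  exact (groupHomology.mapShortComplex₂_exact hX n).isZero_of_both_zeros
    (hY.eq_of_src _ _) (hZ.eq_of_tgt _ _)

end sums

lemma isZero_of_ph {M : ModuleCat.{0} ℤ} {P : Type} [AddCommGroup P] [Subsingleton P] (e : M ≃+ P) :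
    Limits.IsZero M := by
  have : Subsingleton M := e.toEquiv.subsingleton
  exact ModuleCat.isZero_of_subsingleton M

namespace Amal
variable {G E S : Type} [Group G] [Group E] [Group S] {i : G →* E}

lemma exHc (D : Amal i S) (v : D.Vt →₀ ℤ) (h2 : D.aug v = 0) : ∃ u, D.del u = v := by
  refine ⟨D.hc v, ?_⟩
  have h1 := D.del_hc v
  rwa [h2, zero_smul, sub_zero] at h1

lemma mayer_vietoris (D : Amal i S) (hi : Function.Injective i) (hE : ∀ n, Subsingleton (PH E n)) (n : ℕ) :
    Nonempty (PH S (n + 1) ≃+ PH G n) := by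
  let f : Rep.of (pr S (S ⧸ D.H0)) ⟶ Rep.of (pr S D.Vt) := Rep.ofHom ⟨D.del, by
    intro g
    exact LinearMap.ext (D.del_pr g)⟩
  let g : Rep.of (pr S D.Vt) ⟶ Rep.trivial ℤ S ℤ := Rep.ofHom ⟨D.aug, by
    intro g
    exact LinearMap.ext (D.aug_pr g)⟩
  let X : ShortComplex (Rep.{0} ℤ S) := ShortComplex.mk f g (by
    exact Rep.hom_ext (Representation.IntertwiningMap.ext (LinearMap.ext fun v => D.aug_del v)))
  have hX : X.ShortExact :=
    rep_shortExact X (Function.LeftInverse.injective D.hc_del)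
      (fun c => ⟨Finsupp.single (Sum.inl (QuotientGroup.mk 1)) c, D.aug_single _ c⟩) (by
          intro v hv
          exact D.exHc v hv)
  have hz : ∀ m, Limits.IsZero (groupHomology X.X₂ (m + 1)) := by
    intro m
    have hr : ∀ j : E →* S, Function.Injective j →
        Limits.IsZero (groupHomology (Rep.of (pr S (S ⧸ j.range))) (m + 1)) := by
      intro j hj
      obtain ⟨e⟩ := shapiro j.range m
      obtain ⟨e'⟩ := ph_equiv_of_mulEquiv (MonoidHom.ofInjective hj) m
      have := hE m
      exact isZero_of_ph (e.trans e'.symm)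
    exact isZero_sum (m + 1) (hr _ D.i1_inj) (hr _ D.i2_inj)
  have := groupHomology.isIso_δ_of_isZero hX (n + 1) (hz (n + 1)) (hz n)
  let e1 := (asIso (groupHomology.δ hX (n + 2) (n + 1) rfl)).toLinearEquiv.toAddEquiv
  obtain ⟨e2⟩ := groupHomology_equiv S (n + 1)
  obtain ⟨e3⟩ := shapiro D.H0 n
  obtain ⟨e4⟩ := ph_equiv_of_mulEquiv (MonoidHom.ofInjective (f := D.i1.comp i)
    (D.i1_inj.comp hi)) n
  exact ⟨((e2.symm.trans e1).trans e3).trans e4.symm⟩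

end Amal

lemma ph_one (G : Type) [Group G] :
    Nonempty (PH G 0 ≃+ Additive (Abelianization G)) := by
  obtain ⟨e⟩ := groupHomology_equiv G 0
  let e1 := groupHomology.H1AddEquivOfIsTrivial (Rep.trivial ℤ G ℤ)
  exact ⟨(e.symm.trans e1).trans (TensorProduct.rid ℤ (Additive (Abelianization G))).toAddEquiv⟩


/-! ## Centre of the amalgam and assembly -/

namespace Amal
variable {G E S : Type} [Group G] [Group E] [Group S] {i : G →* E}

lemma center_mem (D : Amal i S) (hE : StronglyTorsionGenerated E) (z : S)
    (hz : z ∈ Subgroup.center S) : ∃ x, D.i1 x = z := by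
  classical
  rw [Subgroup.mem_center_iff] at hz
  have hinv : ∀ x, pr S _ (D.i1 x) (D.der z) = D.der z := by
    intro x
    have h1 := D.der_mul (D.i1 x) z
    have h2 := D.der_mul z (D.i1 x)
    rw [hz (D.i1 x), h2, der_i1, map_zero, add_zero, zero_add] at h1
    exact h1.symm
  by_cases h0 : D.der z = 0
  · have h := D.del_der z
    rw [h0, map_zero, eq_comm, sub_eq_zero, v1, v1] at h
    have h' := (Finsupp.single_left_injective (one_ne_zero)) h
    have h'' := Sum.inl_injective h'
    rw [eq_comm, QuotientGroup.eq, inv_one, one_mul] at h''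
    exact h''
  · obtain ⟨q, hq⟩ := Finsupp.ne_iff.1 h0
    have hval : ∀ x r, D.der z (D.i1 x • r) = D.der z r := by
      intro x r
      conv_lhs => rw [← hinv x]
      exact Finsupp.mapDomain_apply (MulAction.injective (D.i1 x)) _ _
    let _ : MulAction E (S ⧸ D.H0) := MulAction.compHom _ D.i1
    have hsub : MulAction.orbit E q ⊆ ((D.der z).support : Set (S ⧸ D.H0)) := by
      rintro _ ⟨x, rfl⟩
      rw [Finset.mem_coe, Finsupp.mem_support_iff]
      show D.der z (D.i1 x • q) ≠ 0
      rw [hval]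
      exact hq
    have hfin : Finite (MulAction.orbit E q) := ((D.der z).support.finite_toSet.subset hsub)
    have hfi : (MulAction.stabilizer E q).FiniteIndex := by
      have : Finite (E ⧸ MulAction.stabilizer E q) :=
        Finite.of_equiv _ (MulAction.orbitEquivQuotientStabilizer E q)
      exact Subgroup.finiteIndex_of_finite_quotient
    have htop := hE.eq_top_of_finiteIndex (MulAction.stabilizer E q)
    have hst : ∀ x, D.i1 x • q = q := by
      intro x
      have : x ∈ MulAction.stabilizer E q := by rw [htop]; trivial
      exact this
    obtain ⟨f, hf1, hf2⟩ := D.exists_fold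
    have hsurj : ∀ y, ∃ g, i g = y := by
      intro y
      induction q using QuotientGroup.induction_on with
      | H s =>
        have h := hst (f s * y * (f s)⁻¹)
        have h' : (QuotientGroup.mk (D.i1 (f s * y * (f s)⁻¹) * s) : S ⧸ D.H0) =
          QuotientGroup.mk s := h
        rw [eq_comm, QuotientGroup.eq] at h'
        obtain ⟨g, hg⟩ := D.mem_H0.1 h'
        refine ⟨g, ?_⟩
        have := congrArg f hg
        simp only [map_mul, map_inv, hf1] at this
        rw [this]; group
    refine D.ind (p := fun z => ∃ x, D.i1 x = z) (fun x => ⟨x, rfl⟩) ?_ ?_ ?_ z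
    · intro x
      obtain ⟨g, rfl⟩ := hsurj x
      exact ⟨i g, D.comm g⟩
    · rintro _ _ ⟨x, rfl⟩ ⟨y, rfl⟩
      exact ⟨x * y, map_mul _ _ _⟩
    · rintro _ ⟨x, rfl⟩
      exact ⟨x⁻¹, map_inv _ _⟩

lemma center_eq_bot (D : Amal i S) (hE : StronglyTorsionGenerated E)
    (hc : Subgroup.center E = ⊥) : Subgroup.center S = ⊥ := by
  rw [eq_bot_iff]
  intro z hz
  obtain ⟨x, rfl⟩ := D.center_mem hE z hz
  rw [Subgroup.mem_center_iff] at hz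
  have : x ∈ Subgroup.center E := by
    rw [Subgroup.mem_center_iff]
    intro y
    apply D.i1_inj
    rw [map_mul, map_mul]
    exact hz _
  rw [hc, Subgroup.mem_bot] at this
  rw [this, map_one]
  exact Subgroup.one_mem _

end Amal

lemma ph_zero_of_perfect {G : Type} [Group G] (h : commutator G = ⊤) : Subsingleton (PH G 0) := by
  obtain ⟨e⟩ := ph_one G
  have : Subsingleton (Abelianization G) := by
    rw [subsingleton_iff_forall_eq 1]
    intro q
    induction q using QuotientGroup.induction_on with
    | H x => exact (QuotientGroup.eq_one_iff x).2 (h ▸ Subgroup.mem_top x)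
  have : Subsingleton (Additive (Abelianization G)) := this
  exact e.toEquiv.subsingleton

lemma StronglyTorsionGenerated.exists_ne {G : Type} [Group G] (h : StronglyTorsionGenerated G) :
    ∃ g : G, g ≠ 1 := by
  obtain ⟨g, hg, -⟩ := h 2 le_rfl
  refine ⟨g, ?_⟩
  rintro rfl
  rw [orderOf_one] at hg
  omega

lemma exists_S2 (C : Type) [CommGroup C] : ∃ (S : Type) (_ : Group S),
    StronglyTorsionGenerated S ∧ Subgroup.center S = ⊥ ∧ Subsingleton (PH S 0) ∧
    Subsingleton (PH S 1) ∧ Nonempty (PH S 2 ≃+ Additive C) := by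
  obtain ⟨E, _, ⟨K⟩⟩ := exists_cone C
  obtain ⟨G, _, ⟨D⟩⟩ := Amal.exists K.i
  obtain ⟨e1⟩ := D.mayer_vietoris K.inj K.acyc 0
  obtain ⟨e2⟩ := ph_one C
  have hG := ph_zero_of_perfect (D.commutator_eq_top K.stg.commutator_eq_top)
  obtain ⟨E', _, ⟨K'⟩⟩ := exists_cone G
  obtain ⟨S, _, ⟨D'⟩⟩ := Amal.exists K'.i
  obtain ⟨f0⟩ := D'.mayer_vietoris K'.inj K'.acyc 0
  obtain ⟨f1⟩ := D'.mayer_vietoris K'.inj K'.acyc 1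
  obtain ⟨x, hx⟩ := K.stg.exists_ne
  have hx' : D.i1 x ≠ 1 := fun h => hx (D.i1_inj (h.trans (map_one _).symm))
  have hS := D'.stg K'.stg ⟨_, K'.nc _ hx'⟩
  refine ⟨S, inferInstance, hS, D'.center_eq_bot K'.stg K'.center,
    ph_zero_of_perfect hS.commutator_eq_top, f0.toEquiv.subsingleton, ⟨?_⟩⟩
  exact ((f1.trans e1).trans e2).trans (MulEquiv.toAdditive (Abelianization.equivOfComm (H := C)).symm)

lemma center_prod_equiv {U S : Type} [Group U] [Group S] (h : Subgroup.center S = ⊥) :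
    Nonempty (Subgroup.center (U × S) ≃* Subgroup.center U) := by
  have h1 : ∀ z : U × S, z ∈ Subgroup.center (U × S) ↔ z.1 ∈ Subgroup.center U ∧ z.2 = 1 := by
    intro z
    constructor
    · intro hz
      rw [Subgroup.mem_center_iff] at hz
      refine ⟨Subgroup.mem_center_iff.2 fun g => congrArg Prod.fst (hz (g, 1)), ?_⟩
      have : z.2 ∈ Subgroup.center S :=
        Subgroup.mem_center_iff.2 fun g => congrArg Prod.snd (hz (1, g))
      rwa [h, Subgroup.mem_bot] at this
    · rintro ⟨h1, h2⟩
      rw [Subgroup.mem_center_iff] at h1 ⊢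
      intro g
      refine Prod.ext (h1 g.1) ?_
      simp [h2]
  exact ⟨{ toFun := fun z => ⟨z.1.1, ((h1 _).1 z.2).1⟩
           invFun := fun u => ⟨(u.1, 1), (h1 _).2 ⟨u.2, rfl⟩⟩
           left_inv := fun z => Subtype.ext (Prod.ext rfl ((h1 _).1 z.2).2.symm)
           right_inv := fun u => rfl
           map_mul' := fun a b => rfl }⟩

theorem superperfect_realization (A C : Type) [AddCommGroup A] [AddCommGroup C] :
    ∃ (S : Type) (_ : Group S), StronglyTorsionGenerated S ∧
      Subsingleton (grpHomology S 1) ∧ Subsingleton (grpHomology S 2) ∧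
      Nonempty (Subgroup.center S ≃* Multiplicative A) ∧
      Nonempty (grpHomology S 3 ≃+ C) := by
  obtain ⟨U, _, hU, ⟨c⟩, hP⟩ := exists_S1 (Multiplicative A)
  obtain ⟨S, _, hS, hc, h0, h1, ⟨h2⟩⟩ := exists_S2 (Multiplicative C)
  obtain ⟨a0⟩ := grpHomology_equiv (U × S) 0
  obtain ⟨a1⟩ := grpHomology_equiv (U × S) 1
  obtain ⟨a2⟩ := grpHomology_equiv (U × S) 2
  obtain ⟨b0⟩ := hP S 0
  obtain ⟨b1⟩ := hP S 1
  obtain ⟨b2⟩ := hP S 2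
  obtain ⟨d⟩ := center_prod_equiv (U := U) hc
  refine ⟨U × S, inferInstance, hU.prod hS, (a0.trans b0).toEquiv.subsingleton,
    (a1.trans b1).toEquiv.subsingleton, ⟨d.trans c⟩, ⟨?_⟩⟩
  exact ((a2.trans b2).trans h2).trans (AddEquiv.additiveMultiplicative C)
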